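/- arXiv:math/9912103 — 2 statements merged into one kernel-verified Lean document; each statement's English description precedes it below -/
import Mathlib

section
/- Let $c > 1$ and let $a : \mathbb{N} \to \mathbb{N}$ satisfy $a(n+1) > c \cdot a(n)$ for all $n$. Fix $k \ge 2$ and $f \in C_c^\infty(\mathbb{R}^{k-1})$, and define the $k$-level correlation sum $R_k(f,N)(\alpha) = \frac{1}{N} \sum^*_{x_i \le N} \sum_{m \in \mathbb{Z}^{k-1}} f(N(m + \alpha \Delta(x)))$ with $\Delta(x) = (a(x_1)-a(x_2),\dots,a(x_{k-1})-a(x_k))$, the starred sum over distinct $x_1,\dots,x_k \in [1,N]$. Then for every $\epsilon > 0$, the variance $\int_0^1 |R_k(f,N)(\alpha) - \int_0^1 R_k(f,N)(\beta) d\beta|^2 d\alpha$ is $O_{f,\epsilon}(N^{-1+\epsilon})$. -/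
open MeasureTheory

/-- The `k`-level correlation sum `R_k(f,N)(α)`. -/
noncomputable def Rk (a : ℕ → ℕ) (k : ℕ) (f : (Fin (k - 1) → ℝ) → ℝ) (N : ℕ) (α : ℝ) : ℝ :=
  (1 / (N : ℝ)) *
    ∑ x ∈ (Fintype.piFinset fun _ : Fin k => Finset.Icc 1 N).filter Function.Injective,
      ∑' m : Fin (k - 1) → ℤ,
        f fun i => (N : ℝ) * ((m i : ℝ) + α *
          ((a (x ⟨i.1, by have := i.2; omega⟩) : ℝ) -
           (a (x ⟨i.1 + 1, by have := i.2; omega⟩) : ℝ)))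

section Lacunary

variable {c : ℝ} {a : ℕ → ℕ}

theorem lacunary_pow_mul_le (hc : 1 < c) (hlac : ∀ n, c * a n < a (n + 1)) {y z : ℕ} (h : y ≤ z) :
    c ^ (z - y) * (a y : ℝ) ≤ a z := by
  induction z, h using Nat.le_induction with
  | base => simp
  | succ z h ih =>
    rw [Nat.succ_sub h, pow_succ']
    nlinarith [hlac z]

theorem lacunary_strictMono (hc : 1 < c) (hlac : ∀ n, c * a n < a (n + 1)) : StrictMono a := by
  refine strictMono_nat_of_lt_succ fun n => ?_
  have h := hlac n
  have h0 : (0 : ℝ) ≤ a n := Nat.cast_nonneg _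
  exact_mod_cast (by nlinarith : (a n : ℝ) < a (n + 1))

theorem sum_lacunary_ratio_le (hc : 1 < c) (ha : ∀ n, 0 < a n)
    (hlac : ∀ n, c * a n < a (n + 1)) (y M : ℕ) :
    ∑ z ∈ Finset.Icc y M, (a y : ℝ) / a z ≤ c / (c - 1) := by
  have hc0 : 0 < c := by linarith
  have hlt : c⁻¹ < 1 := inv_lt_one_of_one_lt₀ hc
  have hinv : 0 ≤ c⁻¹ := by positivity
  calc ∑ z ∈ Finset.Icc y M, (a y : ℝ) / a z
      ≤ ∑ z ∈ Finset.Icc y M, c⁻¹ ^ (z - y) := by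
        refine Finset.sum_le_sum fun z hz => ?_
        have h := lacunary_pow_mul_le hc hlac (Finset.mem_Icc.1 hz).1
        have hz : (0 : ℝ) < a z := by exact_mod_cast ha z
        rw [div_le_iff₀ hz, inv_pow, inv_mul_eq_div, le_div_iff₀ (by positivity), mul_comm]
        exact h
    _ = ∑ j ∈ (Finset.Icc y M).image (fun z => z - y), c⁻¹ ^ j := by
        rw [Finset.sum_image]
        intro u hu v hv huv
        simp only [Finset.coe_Icc, Set.mem_Icc] at hu hv
        dsimp only at huv
        omega
    _ ≤ ∑' j : ℕ, c⁻¹ ^ j :=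
        (summable_geometric_of_lt_one hinv hlt).sum_le_tsum _ fun _ _ => by positivity
    _ = c / (c - 1) := by
        rw [tsum_geometric_of_lt_one hinv hlt]
        have : c - 1 ≠ 0 := by linarith
        field_simp

theorem card_filter_lacunary_close_le (hc : 1 < c) (ha : ∀ n, 0 < a n)
    (hlac : ∀ n, c * a n < a (n + 1)) {M : ℕ} (hM : 1 ≤ M) (z : ℕ) :
    (((Finset.Icc 1 M).filter fun y => y < z ∧ a z ≤ M * a y).card : ℝ)
      ≤ Real.log M / Real.log c := by
  have hlogc : 0 < Real.log c := Real.log_pos hc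
  have hK : 0 ≤ Real.log M / Real.log c :=
    div_nonneg (Real.log_nonneg (by exact_mod_cast hM)) hlogc.le
  have hsub : ((Finset.Icc 1 M).filter fun y => y < z ∧ a z ≤ M * a y) ⊆
      Finset.Ico (z - ⌊Real.log M / Real.log c⌋₊) z := by
    intro y hy
    simp only [Finset.mem_filter, Finset.mem_Icc, Finset.mem_Ico] at hy ⊢
    obtain ⟨-, hyz, hle⟩ := hy
    refine ⟨?_, hyz⟩
    have h := lacunary_pow_mul_le hc hlac hyz.le
    have hle' : (a z : ℝ) ≤ M * a y := by exact_mod_cast hle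
    have hy0 : (0 : ℝ) < a y := by exact_mod_cast ha y
    have hp : c ^ (z - y) ≤ (M : ℝ) := le_of_mul_le_mul_right (h.trans hle') hy0
    have hl := Real.log_le_log (by positivity) hp
    rw [Real.log_pow] at hl
    have : z - y ≤ ⌊Real.log M / Real.log c⌋₊ := Nat.le_floor ((le_div_iff₀ hlogc).2 hl)
    omega
  refine le_trans (Nat.cast_le.2 (Finset.card_le_card hsub)) ?_
  rw [Nat.card_Ico]
  exact le_trans (Nat.cast_le.2 (by omega)) (Nat.floor_le hK)

end Lacunary

theorem card_filter_abs_mul_add_le (s : Finset ℤ) (A T : ℕ) (hA : 0 < A) (V : ℤ) :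
    ((s.filter fun u => |u * A + V| ≤ (T : ℤ)).card : ℝ) ≤ 1 + 2 * (T / A) := by
  have hA' : (0 : ℝ) < A := by exact_mod_cast hA
  have hsub : (s.filter fun u => |u * A + V| ≤ (T : ℤ)) ⊆
      Finset.Icc ⌈(-(T : ℝ) - V) / A⌉ ⌊((T : ℝ) - V) / A⌋ := by
    intro u hu
    have h := abs_le.1 (Finset.mem_filter.1 hu).2
    have h1 : (-(T : ℝ)) ≤ u * A + V := by exact_mod_cast h.1
    have h2 : (u : ℝ) * A + V ≤ T := by exact_mod_cast h.2
    rw [Finset.mem_Icc, Int.ceil_le, Int.le_floor, div_le_iff₀ hA', le_div_iff₀ hA']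
    constructor <;> linarith
  refine le_trans (Nat.cast_le.2 (Finset.card_le_card hsub)) ?_
  rw [Int.card_Icc]
  have h1 := Int.le_ceil ((-(T : ℝ) - V) / A)
  have h2 := Int.floor_le (((T : ℝ) - V) / A)
  have h3 : ((T : ℝ) - V) / A - (-(T : ℝ) - V) / A = 2 * (T / A) := by ring
  have h4 : (0 : ℝ) ≤ 1 + 2 * (T / A) := by positivity
  rw [← Int.cast_natCast, Int.toNat_eq_max, Int.cast_max]
  refine max_le ?_ (by simpa using h4)
  push_cast
  linarith

/-- Tuples of positions in `[y, M]` and coefficients in `[-M, M]`. -/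
noncomputable def coeffTuples (r y M : ℕ) : Finset (Fin r → ℕ × ℤ) :=
  Fintype.piFinset fun _ => Finset.Icc y M ×ˢ Finset.Icc (-(M : ℤ)) M

/-- The linear form `∑ cᵢ a(zᵢ)` of a tuple of pairs `(zᵢ, cᵢ)`. -/
def linForm (a : ℕ → ℕ) {r : ℕ} (p : Fin r → ℕ × ℤ) : ℤ := ∑ i, (p i).2 * (a (p i).1 : ℤ)

theorem mem_coeffTuples {r y M : ℕ} {p : Fin r → ℕ × ℤ} :
    p ∈ coeffTuples r y M ↔ ∀ i, (y ≤ (p i).1 ∧ (p i).1 ≤ M) ∧ |(p i).2| ≤ M := by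
  simp [coeffTuples, abs_le]

theorem linForm_eq_removeNth (a : ℕ → ℕ) {r : ℕ} (p : Fin (r + 1) → ℕ × ℤ) (j : Fin (r + 1)) :
    linForm a p = (p j).2 * (a (p j).1 : ℤ) + linForm a (j.removeNth p) :=
  Fin.sum_univ_succAbove _ j

/-- Tuples whose linear form is at most `B a(y)` in absolute value. -/
noncomputable def smallTuples (a : ℕ → ℕ) (r y M B : ℕ) : Finset (Fin r → ℕ × ℤ) :=
  (coeffTuples r y M).filter fun p => |linForm a p| ≤ ((B * a y : ℕ) : ℤ)

theorem removeNth_mem_smallTuples {a : ℕ → ℕ} (hmono : Monotone a) {r y M B : ℕ} (hMB : M ≤ B)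
    {p : Fin (r + 1) → ℕ × ℤ} (hp : p ∈ smallTuples a (r + 1) y M B) {j : Fin (r + 1)}
    (hj : ∀ i, (p j).1 ≤ (p i).1) :
    j.removeNth p ∈ smallTuples a r (p j).1 M (2 * B) := by
  simp only [smallTuples, Finset.mem_filter, mem_coeffTuples] at hp ⊢
  obtain ⟨hp, hs⟩ := hp
  refine ⟨fun i => ⟨⟨hj _, (hp _).1.2⟩, (hp _).2⟩, ?_⟩
  rw [linForm_eq_removeNth a p j] at hs
  have hya : (a y : ℤ) ≤ a (p j).1 := by exact_mod_cast hmono (hp j).1.1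
  have hcj := (hp j).2
  have hA : (0 : ℤ) ≤ a (p j).1 := by positivity
  have h1 : |(p j).2 * (a (p j).1 : ℤ)| ≤ B * a (p j).1 := by
    rw [abs_mul, abs_of_nonneg hA]
    exact mul_le_mul_of_nonneg_right (hcj.trans (by exact_mod_cast hMB)) hA
  have h2 : ((B * a y : ℕ) : ℤ) ≤ B * a (p j).1 := by
    push_cast
    exact mul_le_mul_of_nonneg_left hya (by positivity)
  rw [abs_le] at *
  push_cast at *
  constructor <;> linarith

theorem card_smallTuples_le {c : ℝ} {a : ℕ → ℕ} (hc : 1 < c) (ha : ∀ n, 0 < a n)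
    (hlac : ∀ n, c * a n < a (n + 1)) (r : ℕ) :
    ∃ C : ℝ, 0 ≤ C ∧ ∀ M B y : ℕ, M ≤ B → 1 ≤ B →
      ((smallTuples a r y M B).card : ℝ) ≤ C * (B : ℝ) ^ r := by
  have hmono := (lacunary_strictMono hc hlac).monotone
  induction r with
  | zero =>
    refine ⟨1, zero_le_one, fun M B y _ _ => ?_⟩
    have := Finset.card_le_univ (smallTuples a 0 y M B)
    simpa using this
  | succ r ih =>
    obtain ⟨C, hC, ih⟩ := ih
    have hG : 0 ≤ c / (c - 1) := div_nonneg (by linarith) (by linarith)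
    refine ⟨(r + 1) * (C * 2 ^ r * (2 + 2 * (c / (c - 1)))), by positivity, fun M B y hMB hB => ?_⟩
    have hsub : smallTuples a (r + 1) y M B ⊆
        Finset.univ.biUnion fun j : Fin (r + 1) => (Finset.Icc y M).biUnion fun z =>
          (smallTuples a r z M (2 * B)).biUnion fun q =>
            ((Finset.Icc (-(M : ℤ)) M).filter
              fun u => |u * a z + linForm a q| ≤ ((B * a y : ℕ) : ℤ)).image
                fun u => j.insertNth (α := fun _ => ℕ × ℤ) (z, u) q := by
      intro p hp
      obtain ⟨j, hj⟩ := Finite.exists_min fun i => (p i).1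
      have hp' := hp
      simp only [smallTuples, Finset.mem_filter, mem_coeffTuples] at hp'
      simp only [Finset.mem_biUnion, Finset.mem_univ, true_and, Finset.mem_image,
        Finset.mem_filter, Finset.mem_Icc]
      refine ⟨j, (p j).1, (hp'.1 j).1, j.removeNth p, removeNth_mem_smallTuples hmono hMB hp hj,
        (p j).2, ⟨abs_le.1 (hp'.1 j).2, ?_⟩, ?_⟩
      · rw [← linForm_eq_removeNth]; exact hp'.2
      · exact Fin.insertNth_self_removeNth j p
    have hB' : (1 : ℝ) ≤ B := by exact_mod_cast hB
    have hfib : ∀ z ∈ Finset.Icc y M, ∀ j : Fin (r + 1),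
        ((((smallTuples a r z M (2 * B)).biUnion fun q =>
            ((Finset.Icc (-(M : ℤ)) M).filter
              fun u => |u * a z + linForm a q| ≤ ((B * a y : ℕ) : ℤ)).image
                fun u => j.insertNth (α := fun _ => ℕ × ℤ) (z, u) q).card : ℕ) : ℝ)
          ≤ C * (2 * B) ^ r * (1 + 2 * B * (a y / a z)) := by
      intro z _ j
      have h1 : ((smallTuples a r z M (2 * B)).card : ℝ) ≤ C * (2 * B) ^ r := by
        have := ih M (2 * B) z (by omega) (by omega)
        push_cast at this
        exact this
      refine le_trans (Nat.cast_le.2 Finset.card_biUnion_le) ?_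
      push_cast
      refine le_trans (Finset.sum_le_card_nsmul _ _ (1 + 2 * B * ((a y : ℝ) / a z))
        fun q _ => ?_) ?_
      · refine le_trans (Nat.cast_le.2 Finset.card_image_le) ?_
        refine (card_filter_abs_mul_add_le _ (a z) (B * a y) (ha z) _).trans (le_of_eq ?_)
        push_cast
        ring
      · rw [nsmul_eq_mul]
        exact mul_le_mul_of_nonneg_right h1 (by positivity)
    refine le_trans (Nat.cast_le.2 (Finset.card_le_card hsub)) ?_
    refine le_trans (Nat.cast_le.2 Finset.card_biUnion_le) ?_
    push_cast
    refine le_trans (Finset.sum_le_card_nsmul _ _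
      (C * 2 ^ r * (2 + 2 * (c / (c - 1))) * (B : ℝ) ^ (r + 1)) fun j _ => ?_) ?_
    · refine le_trans (Nat.cast_le.2 Finset.card_biUnion_le) ?_
      push_cast
      refine le_trans (Finset.sum_le_sum fun z hz => hfib z hz j) ?_
      rw [← Finset.mul_sum, Finset.sum_add_distrib, ← Finset.mul_sum]
      have h2 := sum_lacunary_ratio_le hc ha hlac y M
      have h3 : (∑ _z ∈ Finset.Icc y M, (1 : ℝ)) ≤ 2 * B := by
        rw [Finset.sum_const, Nat.card_Icc, nsmul_eq_mul, mul_one]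
        have : M + 1 - y ≤ 2 * B := by omega
        exact_mod_cast this
      calc C * (2 * (B : ℝ)) ^ r *
            (∑ _z ∈ Finset.Icc y M, (1 : ℝ) + 2 * B * ∑ z ∈ Finset.Icc y M, (a y : ℝ) / a z)
          ≤ C * (2 * (B : ℝ)) ^ r * (2 * B + 2 * B * (c / (c - 1))) := by gcongr
        _ = _ := by rw [mul_pow]; ring
    · simp only [Finset.card_univ, Fintype.card_fin, nsmul_eq_mul]
      push_cast
      apply le_of_eq
      ring

theorem card_lowest_pairs_le {c : ℝ} {a : ℕ → ℕ} (hc : 1 < c) (ha : ∀ n, 0 < a n)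
    (hlac : ∀ n, c * a n < a (n + 1)) {M : ℕ} (hM : 1 ≤ M) (z : ℕ) (U V : ℤ) :
    ((((Finset.Icc 1 M) ×ˢ (Finset.Icc (-(M : ℤ)) M ×ˢ Finset.Icc (-(M : ℤ)) M)).filter
      fun t : ℕ × ℤ × ℤ => t.1 < z ∧ t.2.1 ≠ 0 ∧ t.2.1 + t.2.2 + U = 0 ∧
        t.2.1 * a t.1 + (t.2.2 * a z + V) = 0).card : ℝ) ≤ Real.log M / Real.log c + 3 := by
  have hmono := lacunary_strictMono hc hlac
  rw [← Finset.card_filter_add_card_filter_not (fun t : ℕ × ℤ × ℤ => a z ≤ M * a t.1)]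
  push_cast
  refine add_le_add ?_ ?_
  · refine le_trans (Nat.cast_le.2 (Finset.card_le_card_of_injOn (t :=
      (Finset.Icc 1 M).filter fun y => y < z ∧ a z ≤ M * a y) (fun t => t.1) ?_ ?_))
      (card_filter_lacunary_close_le hc ha hlac hM z)
    · intro t ht
      simp only [Finset.mem_coe, Finset.mem_product, Finset.mem_filter] at ht ⊢
      exact ⟨ht.1.1.1, ht.1.2.1, ht.2⟩
    · rintro ⟨y, u, v⟩ ht ⟨y', u', v'⟩ ht' (rfl : y = y')
      simp only [Finset.mem_coe, Finset.mem_product, Finset.mem_filter]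
        at ht ht'
      obtain ⟨⟨-, hlt, -, h1, h2⟩, -⟩ := ht
      obtain ⟨⟨-, -, -, h1', h2'⟩, -⟩ := ht'
      have hne : (a y : ℤ) - a z ≠ 0 := by
        have : (a y : ℤ) < a z := by exact_mod_cast hmono hlt
        omega
      have h3 : (u - u') * ((a y : ℤ) - a z) = 0 := by
        linear_combination h2 - h2' - (a z : ℤ) * (h1 - h1')
      have h4 : u = u' := by
        rcases mul_eq_zero.1 h3 with h | h
        · omega
        · exact absurd h hne
      have h5 : v = v' := by omega
      rw [h4, h5]
  · refine le_trans (Nat.cast_le.2 (Finset.card_le_card_of_injOn (t :=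
      (Finset.Icc (-(M : ℤ)) M).filter fun v => |v * a z + V| ≤ ((a z : ℕ) : ℤ))
        (fun t => t.2.2) ?_ ?_))
      ((card_filter_abs_mul_add_le _ (a z) (a z) (ha z) V).trans ?_)
    · intro t ht
      simp only [Finset.mem_coe, Finset.mem_product, Finset.mem_filter,
        not_le] at ht ⊢
      refine ⟨ht.1.1.2.2, ?_⟩
      have h1 : t.2.2 * a z + V = -(t.2.1 * a t.1) := by linarith [ht.1.2.2.2.2]
      have h2 : |t.2.1| ≤ M := abs_le.2 (Finset.mem_Icc.1 ht.1.1.2.1)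
      have h3 : (M : ℤ) * a t.1 ≤ a z := by exact_mod_cast ht.2.le
      rw [h1, abs_neg, abs_mul, Nat.abs_cast]
      exact (mul_le_mul_of_nonneg_right h2 (by positivity)).trans h3
    · rintro ⟨y, u, v⟩ ht ⟨y', u', v'⟩ ht' (rfl : v = v')
      simp only [Finset.mem_coe, Finset.mem_product, Finset.mem_filter]
        at ht ht'
      obtain ⟨⟨-, -, hu, h1, h2⟩, -⟩ := ht
      obtain ⟨⟨-, -, -, h1', h2'⟩, -⟩ := ht'
      have h4 : u = u' := by omega
      subst h4
      have h3 : u * (a y : ℤ) = u * a y' := by linarith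
      have h5 := hmono.injective (Int.natCast_inj.1 (mul_left_cancel₀ hu h3))
      rw [h5]
    · have : (a z : ℝ) ≠ 0 := by exact_mod_cast (ha z).ne'
      rw [div_self this]
      norm_num

/-- Tuples at distinct positions, not all of whose coefficients vanish, such that both the
coefficient sum and the linear form vanish. -/
noncomputable def nullTuples (a : ℕ → ℕ) (r M : ℕ) : Finset (Fin r → ℕ × ℤ) :=
  (coeffTuples r 1 M).filter fun p => Function.Injective (fun i => (p i).1) ∧
    ∑ i, (p i).2 = 0 ∧ linForm a p = 0 ∧ ∃ i, (p i).2 ≠ 0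

theorem card_nullTuples_ne_zero_le {c : ℝ} {a : ℕ → ℕ} (hc : 1 < c) (ha : ∀ n, 0 < a n)
    (hlac : ∀ n, c * a n < a (n + 1)) (r : ℕ) :
    ∃ C : ℝ, 0 ≤ C ∧ ∀ M : ℕ, 1 ≤ M →
      (((nullTuples a (r + 2) M).filter fun p => ∀ i, (p i).2 ≠ 0).card : ℝ)
        ≤ C * (M : ℝ) ^ (r + 1) * (1 + Real.log M) := by
  have hmono := (lacunary_strictMono hc hlac).monotone
  obtain ⟨C, hC, hcard⟩ := card_smallTuples_le hc ha hlac r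
  have hlogc := Real.log_pos hc
  refine ⟨(r + 2) * (r + 1) * (C * 4 ^ r * ((Real.log c)⁻¹ + 3)), by positivity, fun M hM => ?_⟩
  have hlogM : 0 ≤ Real.log M := Real.log_nonneg (by exact_mod_cast hM)
  have hsub : ((nullTuples a (r + 2) M).filter fun p => ∀ i, (p i).2 ≠ 0) ⊆
      Finset.univ.biUnion fun j : Fin (r + 2) => Finset.univ.biUnion fun j' : Fin (r + 1) =>
        (Finset.Icc 1 M).biUnion fun z => (smallTuples a r z M (2 * (2 * M))).biUnion fun q =>
          (((Finset.Icc 1 M) ×ˢ (Finset.Icc (-(M : ℤ)) M ×ˢ Finset.Icc (-(M : ℤ)) M)).filter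
            fun t : ℕ × ℤ × ℤ => t.1 < z ∧ t.2.1 ≠ 0 ∧ t.2.1 + t.2.2 + ∑ i, (q i).2 = 0 ∧
              t.2.1 * a t.1 + (t.2.2 * a z + linForm a q) = 0).image
          fun t => j.insertNth (α := fun _ => ℕ × ℤ) (t.1, t.2.1)
            (j'.insertNth (α := fun _ => ℕ × ℤ) (z, t.2.2) q) := by
    intro p hp
    simp only [nullTuples, Finset.mem_filter] at hp
    obtain ⟨⟨hp, hinj, hsum, hform, -⟩, hne⟩ := hp
    have hps : p ∈ smallTuples a (r + 2) 1 M M := by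
      simp only [smallTuples, Finset.mem_filter]
      exact ⟨hp, by rw [hform, abs_zero]; positivity⟩
    obtain ⟨j, hj⟩ := Finite.exists_min fun i => (p i).1
    have hp1 := removeNth_mem_smallTuples hmono le_rfl hps hj
    obtain ⟨j', hj'⟩ := Finite.exists_min fun i => (j.removeNth p i).1
    have hp2 := removeNth_mem_smallTuples hmono (by omega) hp1 hj'
    rw [mem_coeffTuples] at hp
    have hlt : (p j).1 < (j.removeNth p j').1 := by
      refine lt_of_le_of_ne (hj _) fun h => ?_
      exact (Fin.succAbove_ne j j').symm (hinj h)
    simp only [Finset.mem_biUnion, Finset.mem_univ, true_and, Finset.mem_image,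
      Finset.mem_filter, Finset.mem_Icc, Finset.mem_product]
    refine ⟨j, j', (j.removeNth p j').1, (hp _).1, j'.removeNth (j.removeNth p), hp2,
      ((p j).1, (p j).2, (j.removeNth p j').2), ⟨⟨(hp _).1, abs_le.1 (hp _).2,
        abs_le.1 (hp _).2⟩, hlt, hne j, ?_, ?_⟩, ?_⟩
    · rw [← hsum, Fin.sum_univ_succAbove _ j, Fin.sum_univ_succAbove _ j', add_assoc]
      rfl
    · rw [← linForm_eq_removeNth, ← linForm_eq_removeNth, hform]
    · exact (congrArg (j.insertNth (α := fun _ => ℕ × ℤ) (p j))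
        (Fin.insertNth_self_removeNth j' (j.removeNth p))).trans
          (Fin.insertNth_self_removeNth j p)
  have hM' : (1 : ℝ) ≤ M := by exact_mod_cast hM
  refine le_trans (Nat.cast_le.2 (Finset.card_le_card hsub)) ?_
  refine le_trans (Nat.cast_le.2 Finset.card_biUnion_le) ?_
  push_cast
  have key : ∀ j : Fin (r + 2), ∀ j' : Fin (r + 1), ∀ z ∈ Finset.Icc 1 M,
      ((((smallTuples a r z M (2 * (2 * M))).biUnion fun q =>
          (((Finset.Icc 1 M) ×ˢ (Finset.Icc (-(M : ℤ)) M ×ˢ Finset.Icc (-(M : ℤ)) M)).filter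
            fun t : ℕ × ℤ × ℤ => t.1 < z ∧ t.2.1 ≠ 0 ∧ t.2.1 + t.2.2 + ∑ i, (q i).2 = 0 ∧
              t.2.1 * a t.1 + (t.2.2 * a z + linForm a q) = 0).image
          fun t => j.insertNth (α := fun _ => ℕ × ℤ) (t.1, t.2.1)
            (j'.insertNth (α := fun _ => ℕ × ℤ) (z, t.2.2) q)).card : ℕ) : ℝ) ≤
        C * 4 ^ r * ((Real.log c)⁻¹ + 3) * (M : ℝ) ^ r * (1 + Real.log M) := by
    intro j j' z _
    have h1 : ((smallTuples a r z M (2 * (2 * M))).card : ℝ) ≤ C * (2 * (2 * M)) ^ r := by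
      have := hcard M (2 * (2 * M)) z (by omega) (by omega)
      push_cast at this
      exact this
    refine le_trans (Nat.cast_le.2 Finset.card_biUnion_le) ?_
    push_cast
    refine le_trans (Finset.sum_le_card_nsmul _ _ (Real.log M / Real.log c + 3)
      fun q _ => ?_) ?_
    · exact le_trans (Nat.cast_le.2 Finset.card_image_le)
        (card_lowest_pairs_le hc ha hlac hM z _ _)
    · rw [nsmul_eq_mul]
      have h2 : Real.log M / Real.log c + 3 ≤ ((Real.log c)⁻¹ + 3) * (1 + Real.log M) := by
        have : 0 ≤ (Real.log c)⁻¹ := by positivity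
        rw [div_eq_mul_inv]
        nlinarith
      calc _ ≤ (C * (2 * (2 * M)) ^ r) * (((Real.log c)⁻¹ + 3) * (1 + Real.log M)) := by
            gcongr
        _ = _ := by
            rw [← mul_assoc (2 : ℝ) 2, mul_pow]
            norm_num
            ring
  calc _ ≤ ∑ _j : Fin (r + 2), ∑ _j' : Fin (r + 1), ∑ _z ∈ Finset.Icc 1 M,
        C * 4 ^ r * ((Real.log c)⁻¹ + 3) * (M : ℝ) ^ r * (1 + Real.log M) := by
        refine Finset.sum_le_sum fun j _ => ?_
        refine le_trans (Nat.cast_le.2 Finset.card_biUnion_le) ?_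
        push_cast
        refine Finset.sum_le_sum fun j' _ => ?_
        refine le_trans (Nat.cast_le.2 Finset.card_biUnion_le) ?_
        push_cast
        exact Finset.sum_le_sum fun z hz => key j j' z hz
    _ = _ := by
        simp only [Finset.sum_const, Finset.card_univ, Fintype.card_fin, nsmul_eq_mul,
          Nat.card_Icc, Nat.add_sub_cancel]
        push_cast
        ring

theorem card_nullTuples_le {c : ℝ} {a : ℕ → ℕ} (hc : 1 < c) (ha : ∀ n, 0 < a n)
    (hlac : ∀ n, c * a n < a (n + 1)) (r : ℕ) :
    ∃ C : ℝ, 0 ≤ C ∧ ∀ M : ℕ, 1 ≤ M →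
      ((nullTuples a (r + 1) M).card : ℝ) ≤ C * (M : ℝ) ^ r * (1 + Real.log M) := by
  induction r with
  | zero =>
    refine ⟨0, le_rfl, fun M _ => ?_⟩
    have : nullTuples a (0 + 1) M = ∅ := by
      rw [nullTuples, Finset.filter_eq_empty_iff]
      rintro p - ⟨-, h, -, i, hi⟩
      rw [Fin.sum_univ_one] at h
      exact hi (by rw [Fin.fin_one_eq_zero i]; exact h)
    simp [this]
  | succ r ih =>
    obtain ⟨C₁, hC₁, h₁⟩ := card_nullTuples_ne_zero_le hc ha hlac r
    obtain ⟨C₂, hC₂, h₂⟩ := ih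
    refine ⟨C₁ + (r + 2) * C₂, by positivity, fun M hM => ?_⟩
    rw [← Finset.card_filter_add_card_filter_not (fun p => ∀ i, (p i).2 ≠ 0), Nat.cast_add,
      add_mul, add_mul]
    refine add_le_add (h₁ M hM) ?_
    have hsub : ((nullTuples a (r + 1 + 1) M).filter fun p => ¬ ∀ i, (p i).2 ≠ 0) ⊆
        Finset.univ.biUnion fun j : Fin (r + 2) => (Finset.Icc 1 M).biUnion fun z =>
          (nullTuples a (r + 1) M).image
            fun q => j.insertNth (α := fun _ => ℕ × ℤ) (z, 0) q := by
      intro p hp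
      simp only [nullTuples, Finset.mem_filter, not_forall, not_not] at hp
      obtain ⟨⟨hp, hinj, hsum, hform, i, hi⟩, j, hj⟩ := hp
      simp only [Finset.mem_biUnion, Finset.mem_univ, true_and, Finset.mem_image, nullTuples,
        Finset.mem_filter, Finset.mem_Icc, mem_coeffTuples] at hp ⊢
      refine ⟨j, (p j).1, (hp j).1, j.removeNth p, ⟨fun i => hp _, ?_, ?_, ?_, ?_⟩, ?_⟩
      · exact hinj.comp (Fin.succAbove_right_injective (p := j))
      · rw [Fin.sum_univ_succAbove _ j, hj, zero_add] at hsum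
        exact hsum
      · rwa [linForm_eq_removeNth a p j, hj, zero_mul, zero_add] at hform
      · obtain ⟨i', rfl⟩ := Fin.exists_succAbove_eq (x := i) (y := j) (by rintro rfl; exact hi hj)
        exact ⟨i', hi⟩
      · have : ((p j).1, (0 : ℤ)) = p j := Prod.ext rfl hj.symm
        rw [this]
        exact Fin.insertNth_self_removeNth j p
    refine le_trans (Nat.cast_le.2 (Finset.card_le_card hsub)) ?_
    refine le_trans (Nat.cast_le.2 Finset.card_biUnion_le) ?_
    push_cast
    calc _ ≤ ∑ _j : Fin (r + 2), ∑ _z ∈ Finset.Icc 1 M,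
          C₂ * (M : ℝ) ^ r * (1 + Real.log M) := by
          refine Finset.sum_le_sum fun j _ => ?_
          refine le_trans (Nat.cast_le.2 Finset.card_biUnion_le) ?_
          push_cast
          exact Finset.sum_le_sum fun z _ =>
            (Nat.cast_le.2 Finset.card_image_le).trans (h₂ M hM)
      _ = _ := by
          simp only [Finset.sum_const, Finset.card_univ, Fintype.card_fin, nsmul_eq_mul,
            Nat.card_Icc, Nat.add_sub_cancel]
          push_cast
          ring

/-- Pairs of coefficient tuples, each at distinct positions and with vanishing coefficient sum,
whose linear forms agree and do not vanish. -/
noncomputable def collidingPairs (a : ℕ → ℕ) (k M : ℕ) :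
    Finset ((Fin k → ℕ × ℤ) × (Fin k → ℕ × ℤ)) :=
  (coeffTuples k 1 M ×ˢ coeffTuples k 1 M).filter fun t =>
    (Function.Injective (fun i => (t.1 i).1) ∧ ∑ i, (t.1 i).2 = 0) ∧
    (Function.Injective (fun i => (t.2 i).1) ∧ ∑ i, (t.2 i).2 = 0) ∧
    linForm a t.1 = linForm a t.2 ∧ linForm a t.1 ≠ 0

theorem eq_of_removeNth_eq_of_sum_eq {r : ℕ} {p q : Fin (r + 1) → ℕ × ℤ} {j : Fin (r + 1)}
    (h : j.removeNth p = j.removeNth q) (h1 : (p j).1 = (q j).1)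
    (hs : ∑ i, (p i).2 = ∑ i, (q i).2) : p = q := by
  have h2 : (p j).2 = (q j).2 := by
    rw [Fin.sum_univ_succAbove _ j, Fin.sum_univ_succAbove (fun i => (q i).2) j] at hs
    have : ∑ i, (p (j.succAbove i)).2 = ∑ i, (q (j.succAbove i)).2 :=
      Finset.sum_congr rfl fun i _ => congrArg Prod.snd (congrFun h i)
    linarith
  rw [← Fin.insertNth_self_removeNth j p, ← Fin.insertNth_self_removeNth j q, h,
    Prod.ext h1 h2]

theorem append_inj {α : Type*} {m n : ℕ} {p p' : Fin m → α} {q q' : Fin n → α}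
    (h : Fin.append p q = Fin.append p' q') : p = p' ∧ q = q' := by
  constructor
  · funext i
    simpa using congrFun h (Fin.castAdd n i)
  · funext i
    simpa using congrFun h (Fin.natAdd m i)

theorem linForm_append (a : ℕ → ℕ) {m n : ℕ} (p : Fin m → ℕ × ℤ) (q : Fin n → ℕ × ℤ) :
    linForm a (Fin.append p q) = linForm a p + linForm a q := by
  simp [linForm, Fin.sum_univ_add]

/-- Negate all coefficients of a tuple. -/
def negCoeff {r : ℕ} (p : Fin r → ℕ × ℤ) : Fin r → ℕ × ℤ := fun i => ((p i).1, -(p i).2)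

theorem linForm_negCoeff (a : ℕ → ℕ) {r : ℕ} (p : Fin r → ℕ × ℤ) :
    linForm a (negCoeff p) = -linForm a p := by
  simp [linForm, negCoeff]

theorem negCoeff_injective {r : ℕ} : Function.Injective (negCoeff (r := r)) := by
  intro p q h
  funext i
  have := congrFun h i
  simp only [negCoeff, Prod.mk.injEq, neg_inj] at this
  exact Prod.ext this.1 this.2

theorem card_collidingPairs_disjoint_le (a : ℕ → ℕ) (e M : ℕ) :
    ((collidingPairs a (e + 1) M).filter fun t => ∀ i j, (t.1 i).1 ≠ (t.2 j).1).card
      ≤ (nullTuples a (e + 1 + (e + 1)) M).card := by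
  refine Finset.card_le_card_of_injOn (fun t => Fin.append t.1 (negCoeff t.2)) ?_ ?_
  · rintro ⟨p, q⟩ ht
    simp only [Finset.mem_coe, collidingPairs, Finset.mem_filter, Finset.mem_product,
      mem_coeffTuples] at ht
    obtain ⟨⟨⟨hp, hq⟩, ⟨hpi, hps⟩, ⟨hqi, hqs⟩, heq, hne⟩, hdisj⟩ := ht
    simp only [Finset.mem_coe, nullTuples, Finset.mem_filter, mem_coeffTuples]
    refine ⟨?_, ?_, ?_, ?_, ?_⟩
    · intro i
      refine Fin.addCases (fun i => ?_) (fun i => ?_) i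
      · simpa using hp i
      · simp only [Fin.append_right, negCoeff, abs_neg]
        exact hq i
    · intro i
      refine Fin.addCases (fun i => ?_) (fun i => ?_) i <;> intro j <;>
        refine Fin.addCases (fun j => ?_) (fun j => ?_) j <;> intro h <;>
        simp only [Fin.append_left, Fin.append_right, negCoeff] at h
      · rw [hpi h]
      · exact absurd h (hdisj i j)
      · exact absurd h.symm (hdisj j i)
      · rw [hqi h]
    · refine (Fin.sum_univ_add (fun i => (Fin.append p (negCoeff q) i).2)).trans ?_
      simp only [Fin.append_left, Fin.append_right, negCoeff, Finset.sum_neg_distrib, hps, hqs,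
        neg_zero, add_zero]
    · refine (linForm_append a p (negCoeff q)).trans ?_
      rw [linForm_negCoeff, heq, add_neg_cancel]
    · by_contra! h
      apply hne
      refine Finset.sum_eq_zero fun i _ => ?_
      have := h (Fin.castAdd (e + 1) i)
      simp only [Fin.append_left] at this
      rw [this, zero_mul]
  · rintro ⟨p, q⟩ - ⟨p', q'⟩ - h
    obtain ⟨h1, h2⟩ := append_inj h
    rw [Prod.mk.injEq]
    exact ⟨h1, negCoeff_injective h2⟩

theorem card_collidingPairs_meeting_le (a : ℕ → ℕ) (e M : ℕ) (i j : Fin (e + 1)) :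
    ((collidingPairs a (e + 1) M).filter fun t => (t.1 i).1 = (t.2 j).1).card
      ≤ (smallTuples a (e + e + 1) 1 (2 * M) (2 * M)).card := by
  refine Finset.card_le_card_of_injOn (fun t => Fin.cons (α := fun _ => ℕ × ℤ)
    ((t.1 i).1, (t.1 i).2 - (t.2 j).2)
    (Fin.append (i.removeNth t.1) (j.removeNth (negCoeff t.2)))) ?_ ?_
  · rintro ⟨p, q⟩ ht
    simp only [Finset.mem_coe, collidingPairs, Finset.mem_filter, Finset.mem_product,
      mem_coeffTuples] at ht
    obtain ⟨⟨⟨hp, hq⟩, -, -, heq, -⟩, hij⟩ := ht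
    simp only [Finset.mem_coe, smallTuples, Finset.mem_filter, mem_coeffTuples]
    have hb : ∀ x : ℤ, |x| ≤ M → |x| ≤ (2 * M : ℕ) := fun x hx => hx.trans (by push_cast; omega)
    refine ⟨fun l => ?_, ?_⟩
    · refine Fin.cases ?_ (fun l => ?_) l
      · simp only [Fin.cons_zero]
        refine ⟨⟨(hp i).1.1, (hp i).1.2.trans (by omega)⟩, (abs_sub _ _).trans ?_⟩
        push_cast
        linarith [(hp i).2, (hq j).2]
      · simp only [Fin.cons_succ]
        refine Fin.addCases (fun l => ?_) (fun l => ?_) l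
        · simp only [Fin.append_left, Fin.removeNth]
          exact ⟨⟨(hp _).1.1, (hp _).1.2.trans (by omega)⟩, hb _ (hp _).2⟩
        · simp only [Fin.append_right, Fin.removeNth, negCoeff, abs_neg]
          exact ⟨⟨(hq _).1.1, (hq _).1.2.trans (by omega)⟩, hb _ (hq _).2⟩
    · have h1 := linForm_eq_removeNth a p i
      have h2 := linForm_eq_removeNth a (negCoeff q) j
      rw [linForm_negCoeff] at h2
      simp only [negCoeff] at h2
      have h3 : linForm a (Fin.cons (α := fun _ => ℕ × ℤ) ((p i).1, (p i).2 - (q j).2)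
          (Fin.append (i.removeNth p) (j.removeNth (negCoeff q)))) = 0 := by
        rw [linForm, Fin.sum_univ_succ]
        simp only [Fin.cons_zero, Fin.cons_succ]
        have h4 := linForm_append a (i.removeNth p) (j.removeNth (negCoeff q))
        rw [← hij] at h2
        rw [linForm] at h4
        rw [h4]
        linarith
      rw [h3, abs_zero]
      positivity
  · rintro ⟨p, q⟩ ht ⟨p', q'⟩ ht' h
    simp only [Finset.mem_coe, collidingPairs, Finset.mem_filter, Finset.mem_product] at ht ht'
    obtain ⟨⟨-, ⟨-, hps⟩, ⟨-, hqs⟩, -⟩, hij⟩ := ht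
    obtain ⟨⟨-, ⟨-, hps'⟩, ⟨-, hqs'⟩, -⟩, hij'⟩ := ht'
    obtain ⟨h1, h2⟩ := Fin.cons_inj.1 h
    obtain ⟨h3, h4⟩ := append_inj h2
    have h5 : (p i).1 = (p' i).1 := (Prod.mk.injEq _ _ _ _ ▸ h1).1
    have h6 : p = p' := eq_of_removeNth_eq_of_sum_eq h3 h5 (hps.trans hps'.symm)
    have h7 : negCoeff q = negCoeff q' := by
      refine eq_of_removeNth_eq_of_sum_eq h4 ?_ ?_
      · simp only [negCoeff]
        rw [← hij, ← hij', h5]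
      · simp only [negCoeff, Finset.sum_neg_distrib]
        rw [hqs, hqs']
    rw [h6, negCoeff_injective h7]

theorem card_collidingPairs_le {c : ℝ} {a : ℕ → ℕ} (hc : 1 < c) (ha : ∀ n, 0 < a n)
    (hlac : ∀ n, c * a n < a (n + 1)) (e : ℕ) :
    ∃ C : ℝ, 0 ≤ C ∧ ∀ M : ℕ, 1 ≤ M →
      ((collidingPairs a (e + 1) M).card : ℝ) ≤ C * (M : ℝ) ^ (2 * e + 1) * (1 + Real.log M) := by
  obtain ⟨C₁, hC₁, h₁⟩ := card_nullTuples_le hc ha hlac (e + 1 + e)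
  obtain ⟨C₂, hC₂, h₂⟩ := card_smallTuples_le hc ha hlac (e + e + 1)
  refine ⟨C₁ + (e + 1) * (e + 1) * (C₂ * 2 ^ (2 * e + 1)), by positivity, fun M hM => ?_⟩
  have hlogM : 0 ≤ Real.log M := Real.log_nonneg (by exact_mod_cast hM)
  rw [← Finset.card_filter_add_card_filter_not (fun t => ∀ i j, (t.1 i).1 ≠ (t.2 j).1),
    Nat.cast_add, add_mul, add_mul]
  refine add_le_add ?_ ?_
  · refine le_trans (Nat.cast_le.2 (card_collidingPairs_disjoint_le a e M)) ((h₁ M hM).trans ?_)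
    rw [show e + 1 + e = 2 * e + 1 by omega]
  · have hsub : ((collidingPairs a (e + 1) M).filter fun t => ¬ ∀ i j, (t.1 i).1 ≠ (t.2 j).1) ⊆
        Finset.univ.biUnion fun i => Finset.univ.biUnion fun j =>
          (collidingPairs a (e + 1) M).filter fun t => (t.1 i).1 = (t.2 j).1 := by
      intro t ht
      simp only [Finset.mem_filter, not_forall, not_not] at ht
      obtain ⟨ht, i, j, hij⟩ := ht
      simp only [Finset.mem_biUnion, Finset.mem_univ, true_and, Finset.mem_filter]
      exact ⟨i, j, ht, hij⟩
    refine le_trans (Nat.cast_le.2 (Finset.card_le_card hsub)) ?_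
    refine le_trans (Nat.cast_le.2 Finset.card_biUnion_le) ?_
    push_cast
    calc _ ≤ ∑ _i : Fin (e + 1), ∑ _j : Fin (e + 1),
          C₂ * 2 ^ (2 * e + 1) * (M : ℝ) ^ (2 * e + 1) := by
          refine Finset.sum_le_sum fun i _ => ?_
          refine le_trans (Nat.cast_le.2 Finset.card_biUnion_le) ?_
          push_cast
          refine Finset.sum_le_sum fun j _ => ?_
          refine le_trans (Nat.cast_le.2 (card_collidingPairs_meeting_le a e M i j)) ?_
          refine (h₂ (2 * M) (2 * M) 1 le_rfl (by omega)).trans (le_of_eq ?_)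
          push_cast
          rw [mul_pow, show e + e + 1 = 2 * e + 1 by omega]
          ring
      _ = (e + 1) * (e + 1) * (C₂ * 2 ^ (2 * e + 1)) * (M : ℝ) ^ (2 * e + 1) * 1 := by
          simp only [Finset.sum_const, Finset.card_univ, Fintype.card_fin, nsmul_eq_mul]
          push_cast
          ring
      _ ≤ _ := by
          gcongr
          linarith

theorem summable_inv_one_add_abs_sq : Summable fun m : ℤ => ((1 + |(m : ℝ)|)⁻¹) ^ 2 := by
  have h := Real.summable_one_div_int_pow.2 (by norm_num : 1 < 2)
  refine Summable.of_norm_bounded_eventually h ?_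
  rw [Filter.eventually_cofinite]
  refine (Set.finite_singleton (0 : ℤ)).subset fun m hm => ?_
  by_contra hm0
  refine hm ?_
  have hpos : (0 : ℝ) < |(m : ℝ)| := abs_pos.2 (by exact_mod_cast hm0)
  rw [Real.norm_of_nonneg (by positivity), inv_pow, one_div, ← sq_abs (m : ℝ)]
  gcongr
  linarith

theorem inv_one_add_norm_pow_le_prod {e : ℕ} (n : Fin e → ℤ) :
    ((1 + ‖n‖)⁻¹) ^ (2 * e) ≤ ∏ i, ((1 + |(n i : ℝ)|)⁻¹) ^ 2 := by
  have h : ∀ i ∈ Finset.univ, ((1 + ‖n‖)⁻¹) ^ 2 ≤ ((1 + |(n i : ℝ)|)⁻¹) ^ 2 := fun i _ => by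
    have := norm_le_pi_norm n i
    rw [Int.norm_eq_abs] at this
    gcongr
  refine le_trans (le_of_eq ?_) (Finset.prod_le_prod (fun i _ => by positivity) h)
  rw [Finset.prod_const, pow_mul, Finset.card_univ, Fintype.card_fin]

theorem sum_prod_le_prod_tsum {e : ℕ} {g : ℤ → ℝ} (hg0 : ∀ m, 0 ≤ g m) (hg : Summable g)
    (t : Fin e → Finset ℤ) :
    ∑ n ∈ Fintype.piFinset t, ∏ i, g (n i) ≤ ∏ _i : Fin e, ∑' m, g m := by
  rw [← Finset.prod_univ_sum t fun _ m => g m]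
  exact Finset.prod_le_prod (fun i _ => Finset.sum_nonneg fun _ _ => hg0 _)
    fun i _ => hg.sum_le_tsum _ fun _ _ => hg0 _

theorem summable_prod_apply_of_nonneg {e : ℕ} {g : ℤ → ℝ} (hg0 : ∀ m, 0 ≤ g m) (hg : Summable g) :
    Summable fun n : Fin e → ℤ => ∏ i, g (n i) := by
  refine summable_of_sum_le (fun n => Finset.prod_nonneg fun _ _ => hg0 _) fun s =>
    le_trans (Finset.sum_le_sum_of_subset_of_nonneg (fun n hn => ?_)
      fun _ _ _ => Finset.prod_nonneg fun _ _ => hg0 _)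
      (sum_prod_le_prod_tsum hg0 hg fun i => s.image fun n => n i)
  exact Fintype.mem_piFinset.2 fun i => Finset.mem_image_of_mem (fun n => n i) hn

theorem summable_inv_one_add_norm_pow (e : ℕ) :
    Summable fun n : Fin e → ℤ => ((1 + ‖n‖)⁻¹) ^ (2 * e) := by
  exact (summable_prod_apply_of_nonneg (fun _ => by positivity)
    summable_inv_one_add_abs_sq).of_nonneg_of_le (fun n => by positivity)
    inv_one_add_norm_pow_le_prod

/-- Tuples of distinct integers in `[1, N]`. -/
noncomputable def distinctTuples (k N : ℕ) : Finset (Fin k → ℕ) :=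
  (Fintype.piFinset fun _ : Fin k => Finset.Icc 1 N).filter Function.Injective

/-- The frequency `n · Δ(x)`. -/
def frequency (a : ℕ → ℕ) {e : ℕ} (x : Fin (e + 1) → ℕ) (n : Fin e → ℤ) : ℤ :=
  ∑ i, n i * ((a (x i.castSucc) : ℤ) - a (x i.succ))

/-- The differences `nⱼ - nⱼ₋₁`, with the convention that `n` vanishes outside its range. -/
def diffCoeff {e : ℕ} (n : Fin e → ℤ) (j : Fin (e + 1)) : ℤ :=
  Fin.snoc (α := fun _ => ℤ) n 0 j - Fin.cons (α := fun _ => ℤ) 0 n j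

theorem sum_diffCoeff_mul {e : ℕ} (n : Fin e → ℤ) (b : Fin (e + 1) → ℤ) :
    ∑ j, diffCoeff n j * b j = ∑ i, n i * (b i.castSucc - b i.succ) := by
  simp only [diffCoeff, sub_mul, Finset.sum_sub_distrib, mul_sub]
  rw [Fin.sum_univ_castSucc, Fin.sum_univ_succ (fun j => Fin.cons (α := fun _ => ℤ) 0 n j * b j)]
  simp

theorem sum_diffCoeff {e : ℕ} (n : Fin e → ℤ) : ∑ j, diffCoeff n j = 0 := by
  simpa using sum_diffCoeff_mul n fun _ => 1

theorem abs_diffCoeff_le {e : ℕ} (n : Fin e → ℤ) (j : Fin (e + 1)) :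
    (|diffCoeff n j| : ℝ) ≤ 2 * ‖n‖ := by
  have h : ∀ i, |(n i : ℝ)| ≤ ‖n‖ := fun i => by
    rw [← Int.norm_eq_abs]; exact norm_le_pi_norm n i
  have h1 : |((Fin.snoc (α := fun _ => ℤ) n 0 j : ℤ) : ℝ)| ≤ ‖n‖ := by
    refine Fin.lastCases ?_ (fun i => ?_) j
    · simp
    · simpa using h i
  have h2 : |((Fin.cons (α := fun _ => ℤ) 0 n j : ℤ) : ℝ)| ≤ ‖n‖ := by
    refine Fin.cases ?_ (fun i => ?_) j
    · simp
    · simpa using h i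
  rw [diffCoeff]
  push_cast
  exact (abs_sub _ _).trans (by linarith)

theorem diffCoeff_injective {e : ℕ} : Function.Injective (diffCoeff (e := e)) := by
  intro n n' h
  have key : ∀ j : Fin (e + 1), Fin.cons (α := fun _ => ℤ) 0 n j =
      Fin.cons (α := fun _ => ℤ) 0 n' j := by
    intro j
    induction j using Fin.induction with
    | zero => simp
    | succ i ih =>
      have := congrFun h i.castSucc
      simp only [diffCoeff, Fin.snoc_castSucc] at this
      simp only [Fin.cons_succ]
      linarith
  funext i
  simpa using key i.succ

/-- Positions paired with the coefficients that the frequency gives them. -/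
def positionCoeff {e : ℕ} (x : Fin (e + 1) → ℕ) (n : Fin e → ℤ) : Fin (e + 1) → ℕ × ℤ :=
  fun j => (x j, diffCoeff n j)

theorem linForm_positionCoeff (a : ℕ → ℕ) {e : ℕ} (x : Fin (e + 1) → ℕ) (n : Fin e → ℤ) :
    linForm a (positionCoeff x n) = frequency a x n :=
  sum_diffCoeff_mul n fun j => (a (x j) : ℤ)

theorem positionCoeff_inj {e : ℕ} {x x' : Fin (e + 1) → ℕ} {n n' : Fin e → ℤ}
    (h : positionCoeff x n = positionCoeff x' n') : x = x' ∧ n = n' :=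
  ⟨funext fun j => congrArg Prod.fst (congrFun h j),
    diffCoeff_injective (funext fun j => congrArg Prod.snd (congrFun h j))⟩

theorem positionCoeff_mem_coeffTuples {e N M : ℕ} (hNM : N ≤ M) {T : ℝ} (hT : 2 * T ≤ M)
    {x : Fin (e + 1) → ℕ} (hx : x ∈ distinctTuples (e + 1) N) {n : Fin e → ℤ} (hn : ‖n‖ ≤ T) :
    positionCoeff x n ∈ coeffTuples (e + 1) 1 M := by
  simp only [distinctTuples, Finset.mem_filter, Fintype.mem_piFinset, Finset.mem_Icc] at hx
  rw [mem_coeffTuples]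
  refine fun i => ⟨⟨(hx.1 i).1, (hx.1 i).2.trans hNM⟩, ?_⟩
  have h : (|diffCoeff n i| : ℝ) ≤ M := (abs_diffCoeff_le n i).trans (by linarith)
  exact_mod_cast h

theorem card_frequency_collisions_le (a : ℕ → ℕ) {e N M : ℕ} (hNM : N ≤ M) {T : ℝ}
    (hT : 2 * T ≤ M)
    (s : Finset ((distinctTuples (e + 1) N × (Fin e → ℤ)) ×
      (distinctTuples (e + 1) N × (Fin e → ℤ))))
    (hs : ∀ p ∈ s, frequency a p.1.1 p.1.2 = frequency a p.2.1 p.2.2 ∧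
      frequency a p.1.1 p.1.2 ≠ 0 ∧ ‖p.1.2‖ ≤ T ∧ ‖p.2.2‖ ≤ T) :
    s.card ≤ (collidingPairs a (e + 1) M).card := by
  refine Finset.card_le_card_of_injOn
    (fun p => (positionCoeff p.1.1.1 p.1.2, positionCoeff p.2.1.1 p.2.2)) ?_ ?_
  · rintro ⟨⟨x, n⟩, ⟨x', n'⟩⟩ hp
    obtain ⟨heq, hne, hn, hn'⟩ := hs _ hp
    simp only [Finset.mem_coe, collidingPairs, Finset.mem_filter, Finset.mem_product]
    refine ⟨⟨positionCoeff_mem_coeffTuples hNM hT x.2 hn,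
      positionCoeff_mem_coeffTuples hNM hT x'.2 hn'⟩,
      ⟨(Finset.mem_filter.1 x.2).2, sum_diffCoeff n⟩,
      ⟨(Finset.mem_filter.1 x'.2).2, sum_diffCoeff n'⟩, ?_, ?_⟩
    · rw [linForm_positionCoeff, linForm_positionCoeff]; exact heq
    · rw [linForm_positionCoeff]; exact hne
  · rintro ⟨⟨x, n⟩, ⟨x', n'⟩⟩ - ⟨⟨y, m⟩, ⟨y', m'⟩⟩ - h
    obtain ⟨h1, h2⟩ := Prod.mk.injEq _ _ _ _ ▸ h
    obtain ⟨h3, h4⟩ := positionCoeff_inj h1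
    obtain ⟨h5, h6⟩ := positionCoeff_inj h2
    exact Prod.ext (Prod.ext (Subtype.ext h3) h4) (Prod.ext (Subtype.ext h5) h6)

theorem card_distinctTuples_le (k N : ℕ) : (distinctTuples k N).card ≤ N ^ k := by
  refine (Finset.card_filter_le _ _).trans ?_
  simp

theorem exists_collidingPairs_rpow_le {c : ℝ} {a : ℕ → ℕ} (hc : 1 < c) (ha : ∀ n, 0 < a n)
    (hlac : ∀ n, c * a n < a (n + 1)) (e : ℕ) {ε : ℝ} (hε : 0 < ε) :
    ∃ δ : ℝ, 0 < δ ∧ ∃ C : ℝ, 0 ≤ C ∧ ∀ N : ℕ, 1 ≤ N →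
      ((collidingPairs a (e + 1) ⌈2 * (N : ℝ) ^ (1 + δ)⌉₊).card : ℝ)
        ≤ C * (N : ℝ) ^ (2 * e + 1 + ε) := by
  obtain ⟨C, hC, hcard⟩ := card_collidingPairs_le hc ha hlac e
  set δ : ℝ := min 1 (ε / (2 * e + 3)) with hδdef
  have hδ : 0 < δ := lt_min one_pos (by positivity)
  have hδ1 : δ ≤ 1 := min_le_left _ _
  have hδε : δ * (2 * e + 3) ≤ ε := (le_div_iff₀ (by positivity)).1 (min_le_right _ _)
  refine ⟨δ, hδ, C * (1 + 1 / δ) * 3 ^ ((2 * e + 1 : ℝ) + δ), by positivity, fun N hN => ?_⟩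
  have hN' : (1 : ℝ) ≤ N := by exact_mod_cast hN
  have hpow : 1 ≤ (N : ℝ) ^ (1 + δ) := Real.one_le_rpow hN' (by linarith)
  set M := ⌈2 * (N : ℝ) ^ (1 + δ)⌉₊ with hM
  have hM1 : 1 ≤ M := Nat.one_le_ceil_iff.2 (by linarith)
  have hM1' : (1 : ℝ) ≤ M := by exact_mod_cast hM1
  have hM3 : (M : ℝ) ≤ 3 * (N : ℝ) ^ (1 + δ) := by
    have := Nat.ceil_lt_add_one (a := 2 * (N : ℝ) ^ (1 + δ)) (by linarith)
    linarith
  have hlog : 1 + Real.log M ≤ (1 + 1 / δ) * (M : ℝ) ^ δ := by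
    have h1 := Real.log_le_rpow_div (x := (M : ℝ)) (by linarith) hδ
    have h2 : 1 ≤ (M : ℝ) ^ δ := Real.one_le_rpow hM1' hδ.le
    rw [add_mul, one_mul, div_mul_eq_mul_div, one_mul]
    exact add_le_add h2 h1
  calc ((collidingPairs a (e + 1) M).card : ℝ)
      ≤ C * (M : ℝ) ^ (2 * e + 1) * (1 + Real.log M) := hcard M hM1
    _ ≤ C * (M : ℝ) ^ (2 * e + 1) * ((1 + 1 / δ) * (M : ℝ) ^ δ) := by gcongr
    _ = C * (1 + 1 / δ) * (M : ℝ) ^ ((2 * e + 1 : ℝ) + δ) := by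
        rw [Real.rpow_add (by linarith), ← Real.rpow_natCast (M : ℝ) (2 * e + 1)]
        push_cast
        ring
    _ ≤ C * (1 + 1 / δ) * (3 * (N : ℝ) ^ (1 + δ)) ^ ((2 * e + 1 : ℝ) + δ) := by gcongr
    _ = C * (1 + 1 / δ) * 3 ^ ((2 * e + 1 : ℝ) + δ) *
          (N : ℝ) ^ ((1 + δ) * ((2 * e + 1 : ℝ) + δ)) := by
        rw [Real.mul_rpow (by norm_num) (by positivity), ← Real.rpow_mul (by positivity)]
        ring
    _ ≤ _ := by
        refine mul_le_mul_of_nonneg_left (Real.rpow_le_rpow_of_exponent_le hN' ?_) (by positivity)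
        nlinarith

theorem sum_mul_frequency_collisions_le {c : ℝ} {a : ℕ → ℕ} (hc : 1 < c) (ha : ∀ n, 0 < a n)
    (hlac : ∀ n, c * a n < a (n + 1)) (e : ℕ) {ε : ℝ} (hε : 0 < ε) :
    ∃ A : ℕ, 2 * e ≤ A ∧ ∃ C : ℝ, 0 ≤ C ∧ ∀ N : ℕ, 1 ≤ N →
      ∀ s : Finset ((distinctTuples (e + 1) N × (Fin e → ℤ)) ×
        (distinctTuples (e + 1) N × (Fin e → ℤ))),
      ∑ p ∈ s, (if frequency a p.1.1 p.1.2 = frequency a p.2.1 p.2.2 ∧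
          frequency a p.1.1 p.1.2 ≠ 0 then
          ((1 + ‖p.1.2‖ / N)⁻¹) ^ A * ((1 + ‖p.2.2‖ / N)⁻¹) ^ A else 0)
        ≤ C * (N : ℝ) ^ (2 * e + 1 + ε) := by
  obtain ⟨δ, hδ, C, hC, hcount⟩ := exists_collidingPairs_rpow_le hc ha hlac e hε
  obtain ⟨D, hD⟩ := exists_nat_ge ((6 * e + 2) / δ)
  rw [div_le_iff₀ hδ] at hD
  set S : ℝ := ∑' n : Fin e → ℤ, ((1 + ‖n‖)⁻¹) ^ (2 * e) with hS
  have hsum := summable_inv_one_add_norm_pow e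
  have hS0 : 0 ≤ S := tsum_nonneg fun n => by positivity
  refine ⟨2 * e + D, by omega, C + S ^ 2, by positivity, fun N hN s => ?_⟩
  have hN' : (1 : ℝ) ≤ N := by exact_mod_cast hN
  have hN0 : (0 : ℝ) < N := by linarith
  have hpow : (N : ℝ) ≤ (N : ℝ) ^ (1 + δ) :=
    le_trans (Real.rpow_one _).ge (Real.rpow_le_rpow_of_exponent_le hN' (by linarith))
  set T : ℝ := (N : ℝ) ^ (1 + δ) with hT
  set M := ⌈2 * T⌉₊ with hM
  have hTM : 2 * T ≤ M := Nat.le_ceil _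
  have hNM : N ≤ M := by
    have : (N : ℝ) ≤ M := by linarith
    exact_mod_cast this
  let φ : (Fin e → ℤ) → ℝ := fun n => (1 + ‖n‖ / N)⁻¹
  have hφ0 : ∀ n, 0 ≤ φ n := fun n => by positivity
  have hφ1 : ∀ n, φ n ≤ 1 := fun n => inv_le_one_of_one_le₀ (by
    have : 0 ≤ ‖n‖ / (N : ℝ) := by positivity
    linarith)
  have hφT : ∀ n, T < ‖n‖ → φ n ≤ (N : ℝ) ^ (-δ) := fun n hn => by
    rw [Real.rpow_neg hN0.le]
    refine inv_anti₀ (by positivity) ?_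
    have : (N : ℝ) ^ δ ≤ ‖n‖ / N := by
      rw [le_div_iff₀ hN0]
      refine le_trans (le_of_eq ?_) hn.le
      rw [hT, Real.rpow_add hN0, Real.rpow_one, mul_comm]
    linarith
  have hφN : ∀ n, φ n ≤ N * (1 + ‖n‖)⁻¹ := fun n => by
    rw [← div_eq_mul_inv, le_div_iff₀ (by positivity), inv_mul_le_iff₀ (by positivity)]
    have : (1 + ‖n‖ / N) * N = N + ‖n‖ := by field_simp
    rw [this]
    linarith
  let P : ((distinctTuples (e + 1) N × (Fin e → ℤ)) ×
      (distinctTuples (e + 1) N × (Fin e → ℤ))) → Prop := fun p =>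
    frequency a p.1.1 p.1.2 = frequency a p.2.1 p.2.2 ∧ frequency a p.1.1 p.1.2 ≠ 0 ∧
      ‖p.1.2‖ ≤ T ∧ ‖p.2.2‖ ≤ T
  classical
  have hpt : ∀ p ∈ s, (if frequency a p.1.1 p.1.2 = frequency a p.2.1 p.2.2 ∧
          frequency a p.1.1 p.1.2 ≠ 0 then
          ((1 + ‖p.1.2‖ / N)⁻¹) ^ (2 * e + D) * ((1 + ‖p.2.2‖ / N)⁻¹) ^ (2 * e + D) else 0) ≤
      (if P p then 1 else 0) +
        (N : ℝ) ^ (-δ * D) * (φ p.1.2 ^ (2 * e) * φ p.2.2 ^ (2 * e)) := by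
    intro p _
    change (if _ then φ p.1.2 ^ (2 * e + D) * φ p.2.2 ^ (2 * e + D) else 0) ≤ _
    have hE : (N : ℝ) ^ (-δ * D) = ((N : ℝ) ^ (-δ)) ^ D := by
      rw [Real.rpow_mul hN0.le, Real.rpow_natCast]
    have h1 := hφ0 p.1.2
    have h2 := hφ0 p.2.2
    have hnn : 0 ≤ (N : ℝ) ^ (-δ * D) * (φ p.1.2 ^ (2 * e) * φ p.2.2 ^ (2 * e)) := by positivity
    split_ifs with hq hP hP
    · have : φ p.1.2 ^ (2 * e + D) * φ p.2.2 ^ (2 * e + D) ≤ 1 :=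
        mul_le_one₀ (pow_le_one₀ h1 (hφ1 _)) (by positivity) (pow_le_one₀ h2 (hφ1 _))
      linarith
    · rw [zero_add, pow_add, pow_add, hE]
      have hor : φ p.1.2 ^ D * φ p.2.2 ^ D ≤ ((N : ℝ) ^ (-δ)) ^ D := by
        by_cases hn : ‖p.1.2‖ ≤ T
        · have hn' : T < ‖p.2.2‖ := by
            by_contra hn'
            exact hP ⟨hq.1, hq.2, hn, not_lt.1 hn'⟩
          calc φ p.1.2 ^ D * φ p.2.2 ^ D ≤ 1 * φ p.2.2 ^ D := by
                gcongr
                exact pow_le_one₀ h1 (hφ1 _)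
            _ ≤ _ := by rw [one_mul]; gcongr; exact hφT _ hn'
        · calc φ p.1.2 ^ D * φ p.2.2 ^ D ≤ φ p.1.2 ^ D * 1 := by
                gcongr
                exact pow_le_one₀ h2 (hφ1 _)
            _ ≤ _ := by rw [mul_one]; gcongr; exact hφT _ (not_le.1 hn)
      calc φ p.1.2 ^ (2 * e) * φ p.1.2 ^ D * (φ p.2.2 ^ (2 * e) * φ p.2.2 ^ D)
          = (φ p.1.2 ^ D * φ p.2.2 ^ D) * (φ p.1.2 ^ (2 * e) * φ p.2.2 ^ (2 * e)) := by ring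
        _ ≤ _ := by gcongr
    · linarith
    · linarith
  refine (Finset.sum_le_sum hpt).trans ?_
  rw [Finset.sum_add_distrib, ← Finset.mul_sum, add_mul]
  refine add_le_add ?_ ?_
  · rw [Finset.sum_boole]
    refine le_trans (Nat.cast_le.2 (card_frequency_collisions_le a hNM hTM _ fun p hp => ?_))
      (hcount N hN)
    exact (Finset.mem_filter.1 hp).2
  · have hone : ∀ u : Finset (distinctTuples (e + 1) N × (Fin e → ℤ)),
        ∑ q ∈ u, φ q.2 ^ (2 * e) ≤ (N : ℝ) ^ (3 * e + 1) * S := by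
      intro u
      calc ∑ q ∈ u, φ q.2 ^ (2 * e)
          ≤ ∑ q ∈ Finset.univ ×ˢ u.image Prod.snd, φ q.2 ^ (2 * e) := by
            refine Finset.sum_le_sum_of_subset_of_nonneg (fun q hq => ?_)
              fun q _ _ => pow_nonneg (hφ0 _) _
            exact Finset.mem_product.2 ⟨Finset.mem_univ _, Finset.mem_image_of_mem _ hq⟩
        _ = ((distinctTuples (e + 1) N).card : ℝ) *
              ∑ n ∈ u.image Prod.snd, φ n ^ (2 * e) := by
            rw [Finset.sum_product]
            simp
        _ ≤ (N : ℝ) ^ (e + 1) * ((N : ℝ) ^ (2 * e) * S) := by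
            gcongr
            · exact_mod_cast card_distinctTuples_le (e + 1) N
            · refine le_trans (Finset.sum_le_sum fun n _ =>
                pow_le_pow_left₀ (hφ0 n) (hφN n) (2 * e)) ?_
              simp_rw [mul_pow]
              rw [← Finset.mul_sum]
              gcongr
              exact hsum.sum_le_tsum _ fun _ _ => by positivity
        _ = _ := by rw [← mul_assoc, ← pow_add]; congr 2; omega
    have htwo : ∑ p ∈ s, φ p.1.2 ^ (2 * e) * φ p.2.2 ^ (2 * e) ≤
        ((N : ℝ) ^ (3 * e + 1) * S) * ((N : ℝ) ^ (3 * e + 1) * S) := by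
      calc ∑ p ∈ s, φ p.1.2 ^ (2 * e) * φ p.2.2 ^ (2 * e)
          ≤ ∑ p ∈ s.image Prod.fst ×ˢ s.image Prod.snd,
              φ p.1.2 ^ (2 * e) * φ p.2.2 ^ (2 * e) := by
            refine Finset.sum_le_sum_of_subset_of_nonneg (fun q hq => ?_)
              fun q _ _ => mul_nonneg (pow_nonneg (hφ0 _) _) (pow_nonneg (hφ0 _) _)
            exact Finset.mem_product.2 ⟨Finset.mem_image_of_mem _ hq, Finset.mem_image_of_mem _ hq⟩
        _ = (∑ q ∈ s.image Prod.fst, φ q.2 ^ (2 * e)) *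
              ∑ q ∈ s.image Prod.snd, φ q.2 ^ (2 * e) := by
            rw [Finset.sum_mul_sum, Finset.sum_product]
        _ ≤ _ := mul_le_mul (hone _) (hone _)
            (Finset.sum_nonneg fun q _ => pow_nonneg (hφ0 _) _) (by positivity)
    calc (N : ℝ) ^ (-δ * D) * ∑ p ∈ s, φ p.1.2 ^ (2 * e) * φ p.2.2 ^ (2 * e)
        ≤ (N : ℝ) ^ (-δ * D) *
            (((N : ℝ) ^ (3 * e + 1) * S) * ((N : ℝ) ^ (3 * e + 1) * S)) := by gcongr
      _ = S ^ 2 * (N : ℝ) ^ (-δ * D + (6 * e + 2)) := by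
          rw [Real.rpow_add hN0, show (6 * e + 2 : ℝ) = ((6 * e + 2 : ℕ) : ℝ) by push_cast; rfl,
            Real.rpow_natCast, show 6 * e + 2 = (3 * e + 1) + (3 * e + 1) by ring,
            pow_add (N : ℝ) (3 * e + 1)]
          ring
      _ ≤ _ := by
          refine mul_le_mul_of_nonneg_left (Real.rpow_le_rpow_of_exponent_le hN' ?_) (by positivity)
          have : (0 : ℝ) ≤ e := Nat.cast_nonneg e
          nlinarith

theorem integral_exp_two_pi_int_mul (m : ℤ) :
    ∫ α in (0:ℝ)..1, Complex.exp (2 * Real.pi * Complex.I * m * α) = if m = 0 then 1 else 0 := by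
  split_ifs with h
  · simp [h]
  · have hc : 2 * (Real.pi : ℂ) * Complex.I * m ≠ 0 := by
      simp [h, Real.pi_ne_zero]
    rw [integral_exp_mul_complex hc]
    have : 2 * (Real.pi : ℂ) * Complex.I * m * (1 : ℝ) = m * (2 * Real.pi * Complex.I) := by
      push_cast; ring
    rw [this, Complex.exp_int_mul_two_pi_mul_I]
    simp

theorem norm_exp_two_pi_int_mul (m : ℤ) (α : ℝ) :
    ‖Complex.exp (2 * Real.pi * Complex.I * m * α)‖ = 1 := by
  have : 2 * (Real.pi : ℂ) * Complex.I * m * α = ((2 * Real.pi * m * α : ℝ) : ℂ) * Complex.I := by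
    push_cast; ring
  rw [this, Complex.norm_exp_ofReal_mul_I]

/-- The mean of an absolutely convergent trigonometric series. -/
theorem hasSum_integral_trigonometric {ι : Type*} [Countable ι] {u : ι → ℂ}
    (hu : Summable fun i => ‖u i‖) (μ : ι → ℤ) {H : ℝ → ℂ}
    (hH : ∀ α : ℝ, HasSum (fun i => u i * Complex.exp (2 * Real.pi * Complex.I * μ i * α)) (H α)) :
    HasSum (fun i => if μ i = 0 then u i else 0) (∫ α in (0:ℝ)..1, H α) := by
  have h := intervalIntegral.hasSum_integral_of_dominated_convergence (a := 0) (b := 1)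
    (μ := volume) (f := H)
    (F := fun i (α : ℝ) => u i * Complex.exp (2 * Real.pi * Complex.I * μ i * α))
    (fun i _ => ‖u i‖) (fun i => (by fun_prop : Continuous _).aestronglyMeasurable)
    (fun i => .of_forall fun α _ => by rw [norm_mul, norm_exp_two_pi_int_mul, mul_one])
    (.of_forall fun _ _ => hu) (by simp) (.of_forall fun α _ => hH α)
  refine h.congr_fun fun i => ?_
  rw [intervalIntegral.integral_const_mul, integral_exp_two_pi_int_mul]
  split_ifs <;> simp

theorem hasSum_mul_conj {ι : Type*} {u : ι → ℂ} {z : ℂ} (hu : Summable fun i => ‖u i‖)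
    (h : HasSum u z) :
    HasSum (fun p : ι × ι => u p.1 * (starRingEnd ℂ) (u p.2)) (z * (starRingEnd ℂ) z) := by
  have hu' : Summable fun i => ‖(starRingEnd ℂ) (u i)‖ := by simpa only [RCLike.norm_conj] using hu
  have h' : HasSum (fun i => (starRingEnd ℂ) (u i)) ((starRingEnd ℂ) z) := Complex.hasSum_conj'.2 h
  have hs := summable_mul_of_summable_norm (f := u) (g := fun i => (starRingEnd ℂ) (u i)) hu hu'
  exact HasSum.mul (f := u) (g := fun i => (starRingEnd ℂ) (u i)) h h' hs

/-- The squared modulus of an absolutely convergent real trigonometric series. -/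
theorem HasSum.sq_trigonometric {ι : Type*} {v : ι → ℂ} (hv : Summable fun i => ‖v i‖)
    (μ : ι → ℤ) {α h : ℝ}
    (hh : HasSum (fun i => v i * Complex.exp (2 * Real.pi * Complex.I * μ i * α)) (h : ℂ)) :
    HasSum (fun p : ι × ι => v p.1 * (starRingEnd ℂ) (v p.2) *
      Complex.exp (2 * Real.pi * Complex.I * (μ p.1 - μ p.2 : ℤ) * α)) ((h ^ 2 : ℝ) : ℂ) := by
  have hs : Summable fun i => ‖v i * Complex.exp (2 * Real.pi * Complex.I * μ i * α)‖ := by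
    simpa only [norm_mul, norm_exp_two_pi_int_mul, mul_one] using hv
  have h2 := hasSum_mul_conj hs hh
  rw [Complex.conj_ofReal, ← Complex.ofReal_mul, ← sq] at h2
  refine h2.congr_fun fun p => ?_
  rw [map_mul, mul_mul_mul_comm, ← Complex.exp_conj, ← Complex.exp_add]
  congr 2
  simp only [map_mul, Complex.conj_I, Complex.conj_ofReal, map_ofNat, map_intCast]
  push_cast
  ring

/-- The variance of an absolutely convergent trigonometric series is bounded through the
coincidences between its nonzero frequencies. -/
theorem variance_le_of_hasSum_trigonometric {ι : Type*} [Countable ι] {w : ι → ℂ}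
    (hw : Summable fun i => ‖w i‖) (μ : ι → ℤ) {g : ℝ → ℝ}
    (hg : ∀ α : ℝ, HasSum (fun i => w i * Complex.exp (2 * Real.pi * Complex.I * μ i * α)) (g α : ℂ))
    {B : ℝ} (hB : ∀ s : Finset (ι × ι),
      ∑ p ∈ s, (if μ p.1 = μ p.2 ∧ μ p.1 ≠ 0 then ‖w p.1‖ * ‖w p.2‖ else 0) ≤ B) :
    ∫ α in (0:ℝ)..1, |g α - ∫ β in (0:ℝ)..1, g β| ^ 2 ≤ B := by
  set m := ∫ β in (0:ℝ)..1, g β with hm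
  have hmean := hasSum_integral_trigonometric hw μ hg
  rw [intervalIntegral.integral_ofReal, ← hm] at hmean
  let v : ι → ℂ := fun i => if μ i = 0 then 0 else w i
  have hvle : ∀ i, ‖v i‖ ≤ ‖w i‖ := fun i => by
    simp only [v]; split_ifs <;> simp
  have hv : Summable fun i => ‖v i‖ := hw.of_nonneg_of_le (fun _ => norm_nonneg _) hvle
  have hh : ∀ α : ℝ, HasSum (fun i => v i * Complex.exp (2 * Real.pi * Complex.I * μ i * α))
      ((g α - m : ℝ) : ℂ) := fun α => by
    rw [Complex.ofReal_sub]
    refine ((hg α).sub hmean).congr_fun fun i => ?_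
    simp only [v]
    split_ifs with h <;> simp [h]
  have hv2 : Summable fun p : ι × ι => ‖v p.1 * (starRingEnd ℂ) (v p.2)‖ := by
    simpa only [norm_mul, RCLike.norm_conj] using
      hv.mul_of_nonneg hv (fun _ => norm_nonneg _) fun _ => norm_nonneg _
  have hint := hasSum_integral_trigonometric
    (u := fun p : ι × ι => v p.1 * (starRingEnd ℂ) (v p.2)) hv2
    (fun p => μ p.1 - μ p.2) fun α => (hh α).sq_trigonometric hv μ
  simp only [sq_abs]
  rw [intervalIntegral.integral_ofReal] at hint
  refine (Real.le_norm_self _).trans ?_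
  rw [← Complex.norm_real]
  refine le_of_tendsto hint.norm (.of_forall fun s => (norm_sum_le _ _).trans
    (le_trans (Finset.sum_le_sum fun p _ => ?_) (hB s)))
  simp only [v, sub_eq_zero]
  split_ifs <;> simp_all

/-- The Fourier integral of a function on `ℝ^e`. -/
noncomputable def fourierInt {e : ℕ} (f : (Fin e → ℝ) → ℝ) (ξ : Fin e → ℝ) : ℂ :=
  ∫ v : Fin e → ℝ, Complex.exp (-(2 * Real.pi * Complex.I * ((∑ i, v i * ξ i : ℝ) : ℂ))) * f v

theorem exists_abs_apply_eq_norm {e : ℕ} (he : 0 < e) (ξ : Fin e → ℝ) : ∃ i, |ξ i| = ‖ξ‖ := by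
  have : Nonempty (Fin e) := ⟨⟨0, he⟩⟩
  obtain ⟨i, hi⟩ := Finite.exists_max fun i => ‖ξ i‖
  exact ⟨i, le_antisymm (norm_le_pi_norm ξ i) ((pi_norm_le_iff_of_nonempty _).2 hi)⟩

/-- The dot product as a continuous bilinear form. -/
noncomputable def dotForm (e : ℕ) : (Fin e → ℝ) →L[ℝ] (Fin e → ℝ) →L[ℝ] ℝ :=
  ∑ i, (ContinuousLinearMap.proj (R := ℝ) (φ := fun _ : Fin e => ℝ) i).smulRight
    (ContinuousLinearMap.proj (R := ℝ) (φ := fun _ : Fin e => ℝ) i)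

theorem dotForm_apply {e : ℕ} (v w : Fin e → ℝ) : dotForm e v w = ∑ i, v i * w i := by
  simp [dotForm]

theorem fourierIntegral_dotForm {e : ℕ} (f : (Fin e → ℝ) → ℝ) (ξ : Fin e → ℝ) :
    VectorFourier.fourierIntegral Real.fourierChar volume (dotForm e).toLinearMap₁₂
      (fun v => (f v : ℂ)) ξ = fourierInt f ξ := by
  rw [VectorFourier.fourierIntegral, fourierInt]
  refine integral_congr_ae (.of_forall fun v => ?_)
  have : (dotForm e).toLinearMap₁₂ v ξ = ∑ i, v i * ξ i := dotForm_apply v ξ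
  simp only [this, Circle.smul_def, Real.fourierChar_apply, smul_eq_mul]
  congr 2
  push_cast
  ring

theorem norm_pow_mul_fourierInt_le {e : ℕ} {f : (Fin e → ℝ) → ℝ}
    (he : 0 < e) (hf : ContDiff ℝ (⊤ : ℕ∞) f) (hsupp : HasCompactSupport f) (A : ℕ) :
    ∃ C : ℝ, 0 ≤ C ∧ ∀ ξ, ‖ξ‖ ^ A * ‖fourierInt f ξ‖ ≤ C := by
  have hf' : ContDiff ℝ (⊤ : ℕ∞) fun v => (f v : ℂ) := Complex.ofRealCLM.contDiff.comp hf
  have hs' : HasCompactSupport fun v => (f v : ℂ) := hsupp.comp_left Complex.ofReal_zero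
  have hint : ∀ k n : ℕ, (k : ℕ∞) ≤ ⊤ → (n : ℕ∞) ≤ ⊤ →
      Integrable (fun v => ‖v‖ ^ k * ‖iteratedFDeriv ℝ n (fun v => (f v : ℂ)) v‖) volume := by
    intro k n _ _
    refine Continuous.integrable_of_hasCompactSupport ?_ ?_
    · exact (continuous_norm.pow k).mul
        (hf'.continuous_iteratedFDeriv (by exact_mod_cast le_top)).norm
    · exact (hs'.iteratedFDeriv n).norm.mul_left
  let K : ℝ := (2 * ((0 : ℕ) : ℝ) + 2) ^ A * ∑ p ∈ Finset.range (0 + 1) ×ˢ Finset.range (A + 1),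
    ∫ v : Fin e → ℝ, ‖v‖ ^ p.1 * ‖iteratedFDeriv ℝ p.2 (fun v => (f v : ℂ)) v‖
  have hK : 0 ≤ K := mul_nonneg (by positivity) (Finset.sum_nonneg fun p _ =>
    integral_nonneg fun v => by positivity)
  refine ⟨K, hK, fun ξ => ?_⟩
  obtain ⟨i, hi⟩ := exists_abs_apply_eq_norm he ξ
  have h := VectorFourier.pow_mul_norm_iteratedFDeriv_fourierIntegral_le (dotForm e) hf' hint
    (k := 0) (n := A) le_top le_top (Pi.single i 1) ξ
  rw [norm_iteratedFDeriv_zero, fourierIntegral_dotForm, dotForm_apply] at h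
  simp only [Pi.single_apply, ite_mul, one_mul, zero_mul, Finset.sum_ite_eq', Finset.mem_univ,
    if_true, hi, Pi.norm_single, norm_one, one_pow, pow_zero, mul_one] at h
  exact h

/-- The Fourier integral of a smooth compactly supported function decays rapidly. -/
theorem norm_fourierInt_le {e : ℕ} {f : (Fin e → ℝ) → ℝ}
    (he : 0 < e) (hf : ContDiff ℝ (⊤ : ℕ∞) f) (hsupp : HasCompactSupport f) (A : ℕ) :
    ∃ C : ℝ, 0 ≤ C ∧ ∀ ξ, ‖fourierInt f ξ‖ ≤ C * ((1 + ‖ξ‖)⁻¹) ^ A := by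
  obtain ⟨C₀, hC₀, h₀⟩ := norm_pow_mul_fourierInt_le he hf hsupp 0
  obtain ⟨C, hC, h⟩ := norm_pow_mul_fourierInt_le he hf hsupp A
  refine ⟨2 ^ A * (C₀ + C), by positivity, fun ξ => ?_⟩
  rw [inv_pow, ← div_eq_mul_inv, le_div_iff₀ (by positivity)]
  have h0 := h₀ ξ
  rw [pow_zero, one_mul] at h0
  have hb : (1 + ‖ξ‖) ^ A ≤ 2 ^ A * (1 + ‖ξ‖ ^ A) := by
    have hn := norm_nonneg ξ
    rcases le_total ‖ξ‖ 1 with h1 | h1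
    · calc (1 + ‖ξ‖) ^ A ≤ 2 ^ A := by gcongr; linarith
        _ ≤ 2 ^ A * (1 + ‖ξ‖ ^ A) := le_mul_of_one_le_right (by positivity)
          (by linarith [pow_nonneg hn A])
    · calc (1 + ‖ξ‖) ^ A ≤ (2 * ‖ξ‖) ^ A := by gcongr; linarith
        _ = 2 ^ A * ‖ξ‖ ^ A := mul_pow _ _ _
        _ ≤ 2 ^ A * (1 + ‖ξ‖ ^ A) := by gcongr; linarith
  calc ‖fourierInt f ξ‖ * (1 + ‖ξ‖) ^ A ≤ ‖fourierInt f ξ‖ * (2 ^ A * (1 + ‖ξ‖ ^ A)) := by gcongr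
    _ = 2 ^ A * (‖fourierInt f ξ‖ + ‖ξ‖ ^ A * ‖fourierInt f ξ‖) := by ring
    _ ≤ 2 ^ A * (C₀ + C) := by gcongr; exact h ξ

/-- The periodization of `f (t ·)`. -/
noncomputable def periodization {e : ℕ} (f : (Fin e → ℝ) → ℝ) (t : ℝ) (y : Fin e → ℝ) : ℝ :=
  ∑' m : Fin e → ℤ, f fun i => t * ((m i : ℝ) + y i)

theorem continuous_periodization {e : ℕ} {f : (Fin e → ℝ) → ℝ} (hf : Continuous f)
    {t L : ℝ} (ht : 0 < t) (hL : ∀ v, L ≤ ‖v‖ → f v = 0) : Continuous (periodization f t) := by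
  have hlf : ∀ y : Fin e → ℝ, Set.Finite {m : Fin e → ℤ |
      ((Function.support fun y : Fin e → ℝ => f fun i => t * ((m i : ℝ) + y i)) ∩
        Metric.ball y 1).Nonempty} := fun y => by
    refine (isCompact_closedBall (0 : Fin e → ℤ) (|L| / t + ‖y‖ + 1)).finite_of_discrete.subset ?_
    rintro m ⟨z, hz, hzy⟩
    rw [mem_closedBall_zero_iff]
    have h1 : ‖fun i => t * ((m i : ℝ) + z i)‖ < L := by
      by_contra! h
      exact hz (hL _ h)
    rw [mem_ball_iff_norm] at hzy
    refine (pi_norm_le_iff_of_nonneg (by positivity)).2 fun i => ?_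
    have h2 : |t * ((m i : ℝ) + z i)| < L :=
      lt_of_le_of_lt (norm_le_pi_norm (fun i => t * ((m i : ℝ) + z i)) i) h1
    rw [abs_mul, abs_of_pos ht, ← lt_div_iff₀' ht] at h2
    have h3 : |z i - y i| < 1 := lt_of_le_of_lt (norm_le_pi_norm (z - y) i) hzy
    have h4 : |y i| ≤ ‖y‖ := norm_le_pi_norm y i
    have h5 : L / t ≤ |L| / t := by gcongr; exact le_abs_self L
    rw [Int.norm_eq_abs]
    rw [abs_lt] at h2 h3
    rw [abs_le] at h4 ⊢
    constructor <;> linarith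
  have heq : periodization f t = fun y => ∑ᶠ m : Fin e → ℤ, f fun i => t * ((m i : ℝ) + y i) := by
    funext y
    refine tsum_eq_finsum ((hlf y).subset fun m hm => ⟨y, hm, Metric.mem_ball_self one_pos⟩)
  rw [heq]
  exact continuous_finsum (fun m => by fun_prop)
    fun y => ⟨Metric.ball y 1, Metric.ball_mem_nhds y one_pos, hlf y⟩

theorem periodization_add_int {e : ℕ} (f : (Fin e → ℝ) → ℝ) (t : ℝ) (y : Fin e → ℝ)
    (z : Fin e → ℤ) : periodization f t (fun i => y i + z i) = periodization f t y := by
  rw [periodization, periodization, ←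
    (Equiv.addRight z).tsum_eq fun m : Fin e → ℤ => f fun i => t * ((m i : ℝ) + y i)]
  refine tsum_congr fun m => ?_
  congr 1
  funext i
  simp only [Equiv.coe_addRight, Pi.add_apply]
  push_cast
  ring

theorem periodization_eq_of_norm_le {e : ℕ} {f : (Fin e → ℝ) → ℝ} {t L : ℝ} (ht : 0 < t)
    (hL : ∀ v, L ≤ ‖v‖ → f v = 0) (htL : 2 * L ≤ t) {y : Fin e → ℝ} (hy : ∀ i, |y i| ≤ 1 / 2) :
    periodization f t y = f (t • y) := by
  rw [periodization, tsum_eq_single 0]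
  · congr 1
    funext i
    simp
  · intro m hm
    obtain ⟨i, hi⟩ := Function.ne_iff.1 hm
    apply hL
    refine le_trans ?_ (norm_le_pi_norm _ i)
    have h1 : (1 : ℝ) ≤ |(m i : ℝ)| := by exact_mod_cast Int.one_le_abs hi
    have h2 : 1 / 2 ≤ |(m i : ℝ) + y i| := by
      have := abs_sub_abs_le_abs_sub (m i : ℝ) (-y i)
      rw [abs_neg, sub_neg_eq_add] at this
      linarith [hy i]
    rw [Real.norm_eq_abs, abs_mul, abs_of_pos ht]
    nlinarith

/-- The map `ℝ^e → (ℝ/ℤ)^e`. -/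
def toTorus (e : ℕ) : C(Fin e → ℝ, UnitAddTorus (Fin e)) :=
  ⟨fun y i => (y i : UnitAddCircle), by
    exact continuous_pi fun i => (AddCircle.continuous_mk' 1).comp (continuous_apply i)⟩

theorem isQuotientMap_toTorus (e : ℕ) : Topology.IsQuotientMap (toTorus e) :=
  (IsOpenQuotientMap.piMap fun _ : Fin e =>
    (QuotientAddGroup.isOpenQuotientMap_mk (N := AddSubgroup.zmultiples (1 : ℝ)))).isQuotientMap

theorem exists_torus_lift_periodization {e : ℕ} {f : (Fin e → ℝ) → ℝ} (hf : Continuous f)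
    {t L : ℝ} (ht : 0 < t) (hL : ∀ v, L ≤ ‖v‖ → f v = 0) :
    ∃ G : C(UnitAddTorus (Fin e), ℂ), ∀ y : Fin e → ℝ,
      G (fun i => (y i : UnitAddCircle)) = periodization f t y := by
  let g : C(Fin e → ℝ, ℂ) := ⟨fun y => (periodization f t y : ℂ),
    Complex.continuous_ofReal.comp (continuous_periodization hf ht hL)⟩
  have hfac : Function.FactorsThrough g (toTorus e) := by
    intro y y' h
    have h' : ∀ i, ∃ z : ℤ, y i = y' i + z := fun i => by
      have hi : (y i : UnitAddCircle) = (y' i : UnitAddCircle) := congrFun h i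
      rw [← sub_eq_zero, ← AddCircle.coe_sub, AddCircle.coe_eq_zero_iff] at hi
      obtain ⟨z, hz⟩ := hi
      rw [zsmul_one] at hz
      exact ⟨z, by linarith⟩
    choose z hz using h'
    have : y = fun i => y' i + z i := funext hz
    change ((periodization f t y : ℝ) : ℂ) = periodization f t y'
    rw [this, periodization_add_int]
  refine ⟨(isQuotientMap_toTorus e).lift g hfac, fun y => ?_⟩
  exact congrArg (fun k : C(Fin e → ℝ, ℂ) => k y)
    ((isQuotientMap_toTorus e).lift_comp g hfac)

theorem mFourier_coe {e : ℕ} (n : Fin e → ℤ) (y : Fin e → ℝ) :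
    UnitAddTorus.mFourier n (fun i => (y i : UnitAddCircle)) =
      Complex.exp (2 * Real.pi * Complex.I * ((∑ i, n i * y i : ℝ) : ℂ)) := by
  simp only [UnitAddTorus.mFourier, ContinuousMap.coe_mk, fourier_coe_apply, ← Complex.exp_sum]
  congr 1
  push_cast
  rw [Finset.mul_sum]
  exact Finset.sum_congr rfl fun i _ => by ring

theorem mFourierCoeff_periodization {e : ℕ} {f : (Fin e → ℝ) → ℝ}
    {t L : ℝ} (ht : 0 < t) (hL : ∀ v, L ≤ ‖v‖ → f v = 0) (htL : 2 * L ≤ t)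
    {G : UnitAddTorus (Fin e) → ℂ}
    (hG : ∀ y : Fin e → ℝ, G (fun i => (y i : UnitAddCircle)) = periodization f t y)
    (n : Fin e → ℤ) :
    UnitAddTorus.mFourierCoeff G n = ((t ^ e)⁻¹ : ℝ) * fourierInt f fun i => n i / t := by
  rw [UnitAddTorus.mFourierCoeff_eq_integral G n fun _ => -(1 / 2)]
  have hφ := Measure.integral_comp_smul (volume : Measure (Fin e → ℝ)) (fun v =>
    Complex.exp (-(2 * Real.pi * Complex.I * ((∑ i, v i * (n i / t) : ℝ) : ℂ))) * f v) t
  rw [Module.finrank_fin_fun, abs_of_nonneg (by positivity), Complex.real_smul] at hφ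
  rw [fourierInt, ← hφ]
  symm
  rw [← setIntegral_eq_integral_of_forall_compl_eq_zero
    (s := {x : Fin e → ℝ | ∀ i, x i ∈ Set.Ioc (-(1 / 2) : ℝ) (-(1 / 2) + 1)})]
  · refine setIntegral_congr_fun (MeasurableSet.univ_pi' (t := fun _ : Fin e =>
      Set.Ioc (-(1 / 2) : ℝ) (-(1 / 2) + 1)) fun i => measurableSet_Ioc) fun x hx => ?_
    have hx' : ∀ i, |x i| ≤ 1 / 2 := fun i => abs_le.2 ⟨(hx i).1.le, by linarith [(hx i).2]⟩
    simp only [hG, mFourier_coe, periodization_eq_of_norm_le ht hL htL hx', smul_eq_mul]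
    congr 2
    have : ∑ i, (t • x) i * (n i / t) = ∑ i, n i * x i := Finset.sum_congr rfl fun i _ => by
      simp only [Pi.smul_apply, smul_eq_mul]
      field_simp
    rw [this]
    push_cast
    simp
  · intro x hx
    rw [hL, Complex.ofReal_zero, mul_zero]
    have : ∃ i, 1 / 2 ≤ |x i| := by
      by_contra! h
      exact hx fun i => ⟨by linarith [(abs_lt.1 (h i)).1], by linarith [(abs_lt.1 (h i)).2]⟩
    obtain ⟨i, hi⟩ := this
    refine le_trans ?_ (norm_le_pi_norm _ i)
    rw [Pi.smul_apply, smul_eq_mul, Real.norm_eq_abs, abs_mul, abs_of_pos ht]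
    nlinarith

theorem summable_inv_one_add_norm_div_pow {e A : ℕ} (hA : 2 * e ≤ A) {t : ℝ} (ht : 1 ≤ t) :
    Summable fun n : Fin e → ℤ => ((1 + ‖n‖ / t)⁻¹) ^ A := by
  refine ((summable_inv_one_add_norm_pow e).mul_left (t ^ (2 * e))).of_nonneg_of_le
    (fun n => by positivity) fun n => ?_
  have h0 : 0 ≤ ‖n‖ / t := by positivity
  have h1 : (1 + ‖n‖ / t)⁻¹ ≤ 1 := inv_le_one_of_one_le₀ (by linarith)
  have h2 : (1 + ‖n‖ / t)⁻¹ ≤ t * (1 + ‖n‖)⁻¹ := by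
    rw [← div_eq_mul_inv, le_div_iff₀ (by positivity), inv_mul_le_iff₀ (by positivity)]
    have : (1 + ‖n‖ / t) * t = t + ‖n‖ := by field_simp
    rw [this]
    linarith
  calc ((1 + ‖n‖ / t)⁻¹) ^ A ≤ ((1 + ‖n‖ / t)⁻¹) ^ (2 * e) :=
        pow_le_pow_of_le_one (by positivity) h1 hA
    _ ≤ (t * (1 + ‖n‖)⁻¹) ^ (2 * e) := by gcongr
    _ = _ := mul_pow _ _ _

/-- Poisson summation: the periodization of a smooth compactly supported function is the sum of its
Fourier series, whose coefficients decay rapidly. -/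
theorem exists_hasSum_periodization {e : ℕ} (he : 0 < e) {f : (Fin e → ℝ) → ℝ}
    (hf : ContDiff ℝ (⊤ : ℕ∞) f) (hsupp : HasCompactSupport f) {A : ℕ} (hA : 2 * e ≤ A) :
    ∃ C : ℝ, 0 ≤ C ∧ ∃ t₀ : ℝ, ∀ t : ℝ, 1 ≤ t → t₀ ≤ t → ∃ w : (Fin e → ℤ) → ℂ,
      (∀ n, ‖w n‖ ≤ C * (t ^ e)⁻¹ * ((1 + ‖n‖ / t)⁻¹) ^ A) ∧
      ∀ y : Fin e → ℝ, HasSum (fun n : Fin e → ℤ =>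
        w n * Complex.exp (2 * Real.pi * Complex.I * ((∑ i, n i * y i : ℝ) : ℂ)))
          (periodization f t y : ℂ) := by
  obtain ⟨C, hC, hdecay⟩ := norm_fourierInt_le he hf hsupp A
  obtain ⟨L, hL⟩ := isBounded_iff_forall_norm_le.1 hsupp.isCompact.isBounded
  have hL' : ∀ v, L + 1 ≤ ‖v‖ → f v = 0 := fun v hv => by
    by_contra h
    linarith [hL v (subset_tsupport f h)]
  refine ⟨C, hC, 2 * (L + 1), fun t ht htL => ?_⟩
  have ht0 : 0 < t := by linarith
  obtain ⟨G, hG⟩ := exists_torus_lift_periodization hf.continuous ht0 hL'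
  have hbound : ∀ n, ‖UnitAddTorus.mFourierCoeff G n‖ ≤
      C * (t ^ e)⁻¹ * ((1 + ‖n‖ / t)⁻¹) ^ A := fun n => by
    have hn : ‖fun i => (n i : ℝ) / t‖ = ‖n‖ / t := by
      have h1 : (fun i => (n i : ℝ) / t) = t⁻¹ • fun i => (n i : ℝ) := by
        funext i
        simp [div_eq_inv_mul]
      have h2 : ‖fun i => (n i : ℝ)‖ = ‖n‖ := by
        simp only [Pi.norm_def]
        rfl
      rw [h1, norm_smul, h2, norm_inv, Real.norm_of_nonneg ht0.le, div_eq_inv_mul]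
    rw [mFourierCoeff_periodization ht0 hL' htL hG, norm_mul, Complex.norm_real,
      Real.norm_of_nonneg (by positivity)]
    have := hdecay fun i => (n i : ℝ) / t
    rw [hn] at this
    calc (t ^ e)⁻¹ * ‖fourierInt f fun i => (n i : ℝ) / t‖
        ≤ (t ^ e)⁻¹ * (C * ((1 + ‖n‖ / t)⁻¹) ^ A) := by gcongr
      _ = _ := by ring
  refine ⟨UnitAddTorus.mFourierCoeff G, hbound, fun y => ?_⟩
  have hsum : Summable (UnitAddTorus.mFourierCoeff G) :=
    .of_norm_bounded ((summable_inv_one_add_norm_div_pow hA ht).mul_left _) hbound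
  have h := UnitAddTorus.hasSum_mFourier_series_apply_of_summable hsum fun i => (y i : UnitAddCircle)
  rw [hG] at h
  refine h.congr_fun fun n => ?_
  rw [mFourier_coe, smul_eq_mul]

theorem Rk_eq_sum_periodization (a : ℕ → ℕ) {e : ℕ} (f : (Fin e → ℝ) → ℝ) (N : ℕ) (α : ℝ) :
    Rk a (e + 1) f N α = (N : ℝ)⁻¹ * ∑ x ∈ distinctTuples (e + 1) N,
      periodization f N fun i => α * ((a (x i.castSucc) : ℝ) - a (x i.succ)) := by
  rw [← one_div]
  rfl

theorem sum_mul_frequency_cast (a : ℕ → ℕ) {e : ℕ} (x : Fin (e + 1) → ℕ) (n : Fin e → ℤ) (α : ℝ) :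
    ((∑ i, n i * (α * ((a (x i.castSucc) : ℝ) - a (x i.succ))) : ℝ) : ℂ) = frequency a x n * α := by
  rw [frequency]
  push_cast
  rw [Finset.sum_mul]
  exact Finset.sum_congr rfl fun i _ => by ring

theorem Finset.hasSum_prod_of_hasSum {ι κ : Type*} (s : Finset ι) {u : ι → κ → ℂ} {z : ι → ℂ}
    (hu : ∀ i ∈ s, Summable fun k => ‖u i k‖) (h : ∀ i ∈ s, HasSum (u i) (z i)) :
    (Summable fun p : s × κ => ‖u p.1 p.2‖) ∧
      HasSum (fun p : s × κ => u p.1 p.2) (∑ i ∈ s, z i) := by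
  have hs : Summable fun p : s × κ => ‖u p.1 p.2‖ :=
    (summable_prod_of_nonneg fun _ => norm_nonneg _).2
      ⟨fun i => hu i i.2, (hasSum_fintype _).summable⟩
  refine ⟨hs, ?_⟩
  have h2 := hs.of_norm.hasSum.prod_fiberwise fun i => h i i.2
  have h3 := hasSum_fintype fun i : s => z i
  rw [Finset.sum_coe_sort s z] at h3
  rw [h3.unique h2]
  exact hs.of_norm.hasSum

theorem variance_Rk_le {c : ℝ} (hc : 1 < c) {a : ℕ → ℕ} (ha : ∀ n, 0 < a n)
    (hlac : ∀ n, c * a n < a (n + 1)) {e : ℕ} (he : 0 < e)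
    {f : (Fin e → ℝ) → ℝ} (hf : ContDiff ℝ (⊤ : ℕ∞) f) (hsupp : HasCompactSupport f)
    {ε : ℝ} (hε : 0 < ε) : ∃ κ : ℝ, 0 ≤ κ ∧ ∃ N₀ : ℕ, ∀ N : ℕ, 1 ≤ N → N₀ ≤ N →
      (∫ α in (0:ℝ)..1, |Rk a (e + 1) f N α - ∫ β in (0:ℝ)..1, Rk a (e + 1) f N β| ^ 2)
        ≤ κ * (N : ℝ) ^ (-1 + ε) := by
  obtain ⟨A, hA, C, hC, hcount⟩ := sum_mul_frequency_collisions_le hc ha hlac e hε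
  obtain ⟨D, hD, t₀, hpoisson⟩ := exists_hasSum_periodization he hf hsupp hA
  obtain ⟨N₀, hN₀⟩ := exists_nat_ge t₀
  refine ⟨D ^ 2 * C, by positivity, N₀, fun N hN hN' => ?_⟩
  have h1 : (1 : ℝ) ≤ N := by exact_mod_cast hN
  have hN0 : (0 : ℝ) < N := by linarith
  obtain ⟨w, hw, hsum⟩ := hpoisson N h1 (hN₀.trans (by exact_mod_cast hN'))
  have hws : Summable fun n => ‖w n‖ := Summable.of_nonneg_of_le (fun _ => norm_nonneg _) hw
    ((summable_inv_one_add_norm_div_pow hA h1).mul_left _)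
  let I := distinctTuples (e + 1) N × (Fin e → ℤ)
  have hseries : ∀ α : ℝ, (Summable fun p : I => ‖((N : ℝ)⁻¹ : ℂ) * w p.2‖) ∧
      HasSum (fun p : I => ((N : ℝ)⁻¹ : ℂ) * w p.2 *
        Complex.exp (2 * Real.pi * Complex.I * frequency a (p.1 : Fin (e + 1) → ℕ) p.2 * α))
        (Rk a (e + 1) f N α : ℂ) := fun α => by
    have h2 := Finset.hasSum_prod_of_hasSum (distinctTuples (e + 1) N)
      (u := fun x n => w n * Complex.exp (2 * Real.pi * Complex.I * frequency a x n * α))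
      (z := fun x => (periodization f N fun i => α * ((a (x i.castSucc) : ℝ) - a (x i.succ)) : ℝ))
      (fun x _ => by simpa only [norm_mul, norm_exp_two_pi_int_mul, mul_one] using hws)
      (fun x _ => (hsum _).congr_fun fun n => by
        rw [sum_mul_frequency_cast]
        congr 2
        ring)
    simp only [norm_mul, norm_exp_two_pi_int_mul, mul_one] at h2
    refine ⟨by simpa only [norm_mul] using h2.1.mul_left _, ?_⟩
    rw [Rk_eq_sum_periodization]
    push_cast
    refine (h2.2.mul_left ((N : ℂ)⁻¹)).congr_fun fun p => ?_
    rw [mul_assoc]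
  refine variance_le_of_hasSum_trigonometric (hseries 0).1
    (fun p : I => frequency a (p.1 : Fin (e + 1) → ℕ) p.2) (fun α => (hseries α).2) fun s => ?_
  have hc2 := hcount N hN s
  have hterm : ∀ p : I, ‖((N : ℝ)⁻¹ : ℂ) * w p.2‖ ≤
      D * ((N : ℝ) ^ (e + 1))⁻¹ * ((1 + ‖p.2‖ / N)⁻¹) ^ A := fun p => by
    rw [norm_mul, norm_inv, Complex.norm_real, Real.norm_of_nonneg hN0.le, pow_succ, mul_inv]
    calc (N : ℝ)⁻¹ * ‖w p.2‖
        ≤ (N : ℝ)⁻¹ * (D * ((N : ℝ) ^ e)⁻¹ * ((1 + ‖p.2‖ / N)⁻¹) ^ A) := by gcongr; exact hw _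
      _ = _ := by ring
  calc _ ≤ ∑ p ∈ s, (D * ((N : ℝ) ^ (e + 1))⁻¹) ^ 2 *
        (if frequency a (p.1.1 : Fin (e + 1) → ℕ) p.1.2 = frequency a p.2.1 p.2.2 ∧
          frequency a (p.1.1 : Fin (e + 1) → ℕ) p.1.2 ≠ 0 then
          ((1 + ‖p.1.2‖ / N)⁻¹) ^ A * ((1 + ‖p.2.2‖ / N)⁻¹) ^ A else 0) := by
        refine Finset.sum_le_sum fun p _ => ?_
        split_ifs
        · refine (mul_le_mul (hterm p.1) (hterm p.2) (norm_nonneg _) (by positivity)).trans ?_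
          exact le_of_eq (by ring)
        · simp
    _ = (D * ((N : ℝ) ^ (e + 1))⁻¹) ^ 2 * _ := (Finset.mul_sum _ _ _).symm
    _ ≤ (D * ((N : ℝ) ^ (e + 1))⁻¹) ^ 2 * (C * (N : ℝ) ^ (2 * e + 1 + ε)) := by gcongr
    _ = D ^ 2 * C * (N : ℝ) ^ (-1 + ε) := by
        have : (N : ℝ) ^ (2 * e + 1 + ε) = ((N : ℝ) ^ (e + 1)) ^ 2 * (N : ℝ) ^ (-1 + ε) := by
          rw [← pow_mul, ← Real.rpow_natCast, ← Real.rpow_add hN0]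
          congr 1
          push_cast
          ring
        rw [this]
        field_simp

/-- The variance of the `k`-level correlation sum is `O_{f,ε}(N^(-1+ε))`. -/
theorem stmt9 (c : ℝ) (hc : 1 < c) (a : ℕ → ℕ) (ha : ∀ n, 0 < a n)
    (hlac : ∀ n, c * a n < a (n + 1)) (k : ℕ) (hk : 2 ≤ k)
    (f : (Fin (k - 1) → ℝ) → ℝ) (hf : ContDiff ℝ (⊤ : ℕ∞) f) (hsupp : HasCompactSupport f) :
    ∀ ε : ℝ, 0 < ε → ∃ κ : ℝ, ∀ N : ℕ, 1 ≤ N →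
      (∫ α in (0:ℝ)..1, |Rk a k f N α - ∫ β in (0:ℝ)..1, Rk a k f N β| ^ 2)
        ≤ κ * (N : ℝ) ^ (-1 + ε) := by
  intro ε hε
  obtain ⟨e, rfl⟩ : ∃ e, k = e + 1 := ⟨k - 1, by omega⟩
  obtain ⟨κ, hκ, N₀, h⟩ := variance_Rk_le hc ha hlac (e := e) (by omega) hf hsupp hε
  let V : ℕ → ℝ := fun N =>
    (∫ α in (0:ℝ)..1, |Rk a (e + 1) f N α - ∫ β in (0:ℝ)..1, Rk a (e + 1) f N β| ^ 2) /
      (N : ℝ) ^ (-1 + ε)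
  refine ⟨κ + ∑ N ∈ Finset.range N₀, |V N|, fun N hN => ?_⟩
  have hpos : (0 : ℝ) < (N : ℝ) ^ (-1 + ε) := by positivity
  have hS : 0 ≤ ∑ N ∈ Finset.range N₀, |V N| := Finset.sum_nonneg fun _ _ => abs_nonneg _
  rcases le_or_gt N₀ N with hN' | hN'
  · exact (h N hN hN').trans (by gcongr; linarith)
  · rw [← div_le_iff₀ hpos]
    have h1 : |V N| ≤ ∑ N ∈ Finset.range N₀, |V N| := Finset.single_le_sum
      (f := fun N => |V N|) (fun _ _ => abs_nonneg _) (Finset.mem_range.2 hN')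
    exact (le_abs_self (V N)).trans (by linarith)
end

section
/- Let $c > 1$ and let $a : \mathbb{N} \to \mathbb{N}$ satisfy $a(n+1) > c \cdot a(n)$ for all $n$. Fix $k \ge 2$ and a nonnegative $f \in C_c^\infty(\mathbb{R}^{k-1})$, and define $R_k(f,N)(\alpha)$ as the $k$-level correlation sum. Then for almost every $\alpha$, for every $\epsilon > 0$ there is a constant $C(\alpha, f, \epsilon)$ such that $R_k(f,N)(\alpha) \le C(\alpha, f, \epsilon) N^{\epsilon}$ for all $N \ge 1$. -/
open MeasureTheory

theorem card_chain_le {β : Type*} [DecidableEq β] (S : Finset β) (r : β → β → Prop)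
    [DecidableRel r] (P : ℕ) (hP : ∀ y ∈ S, (S.filter fun x => r y x).card ≤ P) (n : ℕ) :
    ((Fintype.piFinset fun _ : Fin (n + 1) => S).filter
      fun x => ∀ i : Fin n, r (x i.castSucc) (x i.succ)).card ≤ S.card * P ^ n := by
  induction n with
  | zero => simp
  | succ n ih =>
    rw [pow_succ, ← mul_assoc]
    refine le_trans (Finset.card_le_mul_card_image_of_maps_to (f := Fin.init) (t :=
      ((Fintype.piFinset fun _ : Fin (n + 1) => S).filter
      fun x => ∀ i : Fin n, r (x i.castSucc) (x i.succ))) ?_ P ?_)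
      ((mul_comm _ _).trans_le (Nat.mul_le_mul_right P ih))
    · intro x hx
      simp only [Finset.mem_filter, Fintype.mem_piFinset] at hx ⊢
      exact ⟨fun i => hx.1 _, fun i => hx.2 i.castSucc⟩
    · intro y hy
      simp only [Finset.mem_filter, Fintype.mem_piFinset] at hy
      refine le_trans ?_ (hP (y (Fin.last n)) (hy.1 _))
      refine Finset.card_le_card_of_injOn (fun x => x (Fin.last (n + 1))) ?_ ?_
      · intro x hx
        simp only [Finset.coe_filter, Set.mem_ofPred_eq, Finset.mem_filter,
          Fintype.mem_piFinset] at hx ⊢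
        obtain ⟨⟨h1, h2⟩, rfl⟩ := hx
        exact ⟨h1 _, h2 (Fin.last n)⟩
      · intro x hx x' hx' h
        simp only [Finset.coe_filter, Set.mem_ofPred_eq] at hx hx'
        rw [← Fin.snoc_init_self x, ← Fin.snoc_init_self x', hx.2, hx'.2]
        exact congrArg _ h

theorem tsum_le_of_support_bounded {d : ℕ} (f : (Fin d → ℝ) → ℝ) (B : ℝ) (D : ℕ)
    (hB0 : 0 ≤ B) (hB : ∀ y, f y ≤ B) (hD : ∀ y, f y ≠ 0 → ∀ i, |y i| ≤ D)
    (N : ℕ) (hN : 1 ≤ N) (v : Fin d → ℝ) :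
    ∑' m : Fin d → ℤ, f (fun i => (N : ℝ) * ((m i : ℝ) + v i)) ≤ B * (2 * D + 1 : ℝ) ^ d := by
  have hN' : (1 : ℝ) ≤ N := by exact_mod_cast hN
  have hDN : (D : ℝ) / N ≤ D := div_le_self (Nat.cast_nonneg _) hN'
  have hDN0 : 0 ≤ (D : ℝ) / N := by positivity
  let T : Fin d → Finset ℤ := fun i => Finset.Icc ⌈-(D / N : ℝ) - v i⌉ ⌊(D / N : ℝ) - v i⌋
  have hT : ∀ i, ((T i).card : ℝ) ≤ 2 * D + 1 := by
    intro i
    have h1 := Int.floor_le ((D / N : ℝ) - v i)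
    have h2 := Int.le_ceil (-(D / N : ℝ) - v i)
    rw [Int.card_Icc]
    have : (((⌊(D / N : ℝ) - v i⌋ + 1 - ⌈-(D / N : ℝ) - v i⌉).toNat : ℤ) : ℝ) ≤ 2 * D + 1 := by
      rw [Int.toNat_eq_max]
      push_cast
      apply max_le <;> linarith
    exact_mod_cast this
  rw [tsum_eq_sum (s := Fintype.piFinset T)]
  · calc _ ≤ ∑ m ∈ Fintype.piFinset T, B := Finset.sum_le_sum fun m _ => hB _
      _ = B * ∏ i, ((T i).card : ℝ) := by
        rw [Finset.sum_const, Fintype.card_piFinset, nsmul_eq_mul]; push_cast; ring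
      _ ≤ _ := by
        gcongr
        refine (Finset.prod_le_prod (fun _ _ => Nat.cast_nonneg _) fun i _ => hT i).trans ?_
        simp
  · intro m hm
    by_contra h
    apply hm
    rw [Fintype.mem_piFinset]
    intro i
    have := hD _ h i
    rw [abs_mul, abs_of_pos (by linarith : (0 : ℝ) < N), ← le_div_iff₀' (by linarith), abs_le]
      at this
    rw [Finset.mem_Icc, Int.ceil_le, Int.le_floor]
    constructor <;> linarith

/-- The points `α` for which there are `r` indices in `[n, N]`, consecutive ones at distance at
least `L`, at which `α` belongs to the sets `A`. -/
def separatedHits (A : ℕ → Set ℝ) (L N : ℕ) : ℕ → ℕ → Set ℝ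
  | 0, _ => Set.univ
  | r + 1, n => ⋃ x ∈ Finset.Icc n N, A x ∩ separatedHits A L N r (x + L)

open Classical in
theorem card_hits_le (A : ℕ → Set ℝ) (L N : ℕ) (α : ℝ) (r n : ℕ)
    (h : α ∉ separatedHits A L N r n) :
    ((Finset.Icc n N).filter fun x => α ∈ A x).card ≤ r * L := by
  induction r generalizing n with
  | zero => simp [separatedHits] at h
  | succ r ih =>
    rcases Finset.eq_empty_or_nonempty ((Finset.Icc n N).filter fun x => α ∈ A x) with he | he
    · simp [he]
    · have hx := Finset.min'_mem _ he
      set x := Finset.min' _ he with hxdef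
      rw [Finset.mem_filter] at hx
      have h' : α ∉ separatedHits A L N r (x + L) := fun hα =>
        h (Set.mem_iUnion₂.2 ⟨x, hx.1, hx.2, hα⟩)
      have hsub : ((Finset.Icc n N).filter fun x => α ∈ A x) ⊆
          ((Finset.Icc (x + L) N).filter fun x => α ∈ A x) ∪ Finset.Ico x (x + L) := by
        intro y hy
        have hxy : x ≤ y := Finset.min'_le _ _ hy
        simp only [Finset.mem_filter, Finset.mem_union, Finset.mem_Icc, Finset.mem_Ico] at hy ⊢
        by_cases hc : x + L ≤ y
        · exact Or.inl ⟨⟨hc, hy.1.2⟩, hy.2⟩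
        · exact Or.inr ⟨hxy, by omega⟩
      refine (Finset.card_le_card hsub).trans ((Finset.card_union_le _ _).trans ?_)
      have := ih _ h'
      simp only [Nat.card_Ico]
      rw [Nat.succ_mul]
      omega

/-- The `α` for which `b * α` lies modulo one in `[j / N, (j + W) / N]`. -/
def hitSet (N W j : ℕ) (b : ℕ) : Set ℝ :=
  {α | ∃ m : ℤ, m + (j : ℝ) / N ≤ b * α ∧ b * α ≤ m + ((j : ℝ) + W) / N}

theorem volume_hitSet_inter_le (N W j b : ℕ) (hN : 1 ≤ N) (hb : 0 < b) (E : Set ℝ) (κ δ : ℝ)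
    (hκ : 0 ≤ κ)
    (hE : ∀ u v : ℝ, u ≤ v → volume (Set.Icc u v ∩ E) ≤ ENNReal.ofReal ((v - u + δ) * κ))
    (hδb : δ ≤ (W + 1) / (N * b)) (u v : ℝ) (huv : u ≤ v) :
    volume (Set.Icc u v ∩ (hitSet N W j b ∩ E)) ≤
      ENNReal.ofReal ((v - u + (W + 1) / b) * ((2 * W + 1) / N * κ)) := by
  have hN' : (1 : ℝ) ≤ N := by exact_mod_cast hN
  have hN0 : (0 : ℝ) < N := by linarith
  have hb' : (0 : ℝ) < b := by exact_mod_cast hb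
  let T : Finset ℤ := Finset.Icc ⌈b * u - ((j : ℝ) + W) / N⌉ ⌊b * v - (j : ℝ) / N⌋
  have hW : (W : ℝ) / N ≤ W := div_le_self (Nat.cast_nonneg _) hN'
  have hW0 : 0 ≤ (W : ℝ) / N := by positivity
  have hT : (T.card : ℝ) ≤ b * (v - u) + W + 1 := by
    have h1 := Int.floor_le (b * v - (j : ℝ) / N)
    have h2 := Int.le_ceil (b * u - ((j : ℝ) + W) / N)
    rw [add_div] at h2
    have h3 : 0 ≤ b * (v - u) := mul_nonneg hb'.le (by linarith)
    rw [Int.card_Icc, add_div]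
    have : (((⌊b * v - (j : ℝ) / N⌋ + 1 - ⌈b * u - ((j : ℝ) / N + W / N)⌉).toNat : ℤ) : ℝ)
        ≤ b * (v - u) + W + 1 := by
      rw [Int.toNat_eq_max]
      push_cast
      apply max_le <;> linarith
    exact_mod_cast this
  have hsub : Set.Icc u v ∩ (hitSet N W j b ∩ E) ⊆
      ⋃ m ∈ T, (Set.Icc ((m + (j : ℝ) / N) / b) ((m + ((j : ℝ) + W) / N) / b) ∩ E) := by
    rintro α ⟨⟨h1, h2⟩, ⟨m, hm1, hm2⟩, hα⟩
    have h3 := mul_le_mul_of_nonneg_left h1 hb'.le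
    have h4 := mul_le_mul_of_nonneg_left h2 hb'.le
    refine Set.mem_iUnion₂.2 ⟨m, ?_, ⟨?_, ?_⟩, hα⟩
    · rw [Finset.mem_Icc, Int.ceil_le, Int.le_floor]
      constructor <;> linarith
    · rwa [div_le_iff₀' hb']
    · rwa [le_div_iff₀' hb']
  calc volume (Set.Icc u v ∩ (hitSet N W j b ∩ E))
      ≤ ∑ m ∈ T, volume (Set.Icc ((m + (j : ℝ) / N) / b) ((m + ((j : ℝ) + W) / N) / b) ∩ E) :=
        (measure_mono hsub).trans (measure_biUnion_finset_le _ _)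
    _ ≤ ∑ m ∈ T, ENNReal.ofReal ((2 * W + 1) / (N * b) * κ) := by
        refine Finset.sum_le_sum fun m _ => (hE _ _ ?_).trans (ENNReal.ofReal_le_ofReal ?_)
        · rw [add_div (j : ℝ)]
          gcongr
          linarith
        · refine mul_le_mul_of_nonneg_right ?_ hκ
          have : (m + ((j : ℝ) + W) / N) / b - (m + (j : ℝ) / N) / b = W / (N * b) := by
            field_simp; ring
          rw [this, show (2 * W + 1 : ℝ) / (N * b) = W / (N * b) + (W + 1) / (N * b) by
            field_simp; ring]
          linarith
    _ = ENNReal.ofReal (T.card * ((2 * W + 1) / (N * b) * κ)) := by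
        rw [Finset.sum_const, nsmul_eq_mul, ENNReal.ofReal_mul (Nat.cast_nonneg _),
          ENNReal.ofReal_natCast]
    _ ≤ _ := by
        apply ENNReal.ofReal_le_ofReal
        calc (T.card : ℝ) * ((2 * W + 1) / (N * b) * κ)
            ≤ (b * (v - u) + W + 1) * ((2 * W + 1) / (N * b) * κ) := by gcongr
          _ = _ := by field_simp; ring

theorem sum_Icc_choose_sub (N n r : ℕ) :
    ∑ x ∈ Finset.Icc n N, (N - x).choose r = (N + 1 - n).choose (r + 1) := by
  by_cases h : n ≤ N
  · obtain ⟨d, rfl⟩ := Nat.exists_eq_add_of_le h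
    clear h
    induction d generalizing n with
    | zero => cases r <;> simp [Nat.choose_succ_succ']
    | succ d ih =>
      have := ih (n + 1)
      rw [show n + 1 + d = n + (d + 1) by ring] at this
      rw [← Finset.insert_Icc_add_one_left_eq_Icc (by omega : n ≤ n + (d + 1)),
        Finset.sum_insert (by simp), this, show n + (d + 1) + 1 - n = (d + 1) + 1 by omega,
        show n + (d + 1) + 1 - (n + 1) = d + 1 by omega, show n + (d + 1) - n = d + 1 by omega,
        Nat.choose_succ_succ' (d + 1) r]
  · rw [Finset.Icc_eq_empty h, show N + 1 - n = 0 by omega]; simp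

theorem volume_separatedHits_le (a : ℕ → ℕ) (ha : ∀ n, 0 < a n) (hmono : Monotone a)
    (N W j L : ℕ) (hN : 1 ≤ N) (hL : 1 ≤ L) (hgap : ∀ n, N * a n ≤ a (n + L)) (r n : ℕ) (u v : ℝ)
    (huv : u ≤ v) :
    volume (Set.Icc u v ∩ separatedHits (fun x => hitSet N W j (a x)) L N r n) ≤
      ENNReal.ofReal ((v - u + (W + 1) / a n) *
        (((2 * W + 1) / N) ^ r * ((N + 1 - n).choose r : ℕ))) := by
  have ha' : ∀ n, (0 : ℝ) < a n := fun n => by exact_mod_cast ha n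
  have hN0 : (0 : ℝ) < N := by exact_mod_cast hN
  induction r generalizing n u v with
  | zero =>
    simp only [separatedHits, Set.inter_univ, Real.volume_Icc, pow_zero, Nat.choose_zero_right,
      Nat.cast_one, mul_one]
    have := ha' n
    exact ENNReal.ofReal_le_ofReal (le_add_of_nonneg_right (by positivity))
  | succ r ih =>
    have hmem : ∀ x ∈ Finset.Icc n N,
        volume (Set.Icc u v ∩ (hitSet N W j (a x) ∩
          separatedHits (fun x => hitSet N W j (a x)) L N r (x + L))) ≤
        ENNReal.ofReal ((v - u + (W + 1) / a n) *
          (((2 * W + 1) / N) ^ (r + 1) * ((N - x).choose r : ℕ))) := by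
      intro x hx
      refine (volume_hitSet_inter_le N W j (a x) hN (ha x) _
        (((2 * W + 1) / N) ^ r * ((N + 1 - (x + L)).choose r : ℕ)) ((W + 1) / a (x + L))
        (by positivity) (fun u v huv => ih _ _ _ huv) ?_ u v huv).trans
        (ENNReal.ofReal_le_ofReal ?_)
      · have := ha' x
        gcongr
        exact_mod_cast hgap x
      · rw [pow_succ', mul_assoc ((2 * W + 1 : ℝ) / N)]
        have h1 := ha' n
        have h2 : (a n : ℝ) ≤ a x := by exact_mod_cast hmono (Finset.mem_Icc.1 hx).1
        have h3 : (N + 1 - (x + L)).choose r ≤ (N - x).choose r :=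
          Nat.choose_le_choose r (by omega)
        have h4 : 0 ≤ v - u := by linarith
        gcongr
    have hcoef : 0 ≤ v - u + (W + 1 : ℝ) / a n := by
      have := ha' n
      have : 0 ≤ (W + 1 : ℝ) / a n := by positivity
      linarith
    simp only [separatedHits, Set.inter_iUnion₂]
    refine (measure_biUnion_finset_le _ _).trans ((Finset.sum_le_sum hmem).trans_eq ?_)
    rw [← ENNReal.ofReal_sum_of_nonneg (fun x _ => by positivity), ← Finset.mul_sum,
      ← Finset.mul_sum, ← sum_Icc_choose_sub]
    push_cast
    rfl

theorem pow_mul_le_of_lacunary {c : ℝ} (hc : 0 ≤ c) {a : ℕ → ℕ}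
    (hlac : ∀ n, c * a n < a (n + 1)) (L n : ℕ) : c ^ L * a n ≤ a (n + L) := by
  induction L with
  | zero => simp
  | succ L ih =>
    calc c ^ (L + 1) * a n = c * (c ^ L * a n) := by ring
      _ ≤ c * a (n + L) := by gcongr
      _ ≤ a (n + (L + 1)) := (hlac _).le

theorem monotone_of_lacunary {c : ℝ} (hc : 1 ≤ c) {a : ℕ → ℕ}
    (hlac : ∀ n, c * a n < a (n + 1)) : Monotone a := by
  refine monotone_nat_of_le_succ fun n => ?_
  have h := (le_mul_of_one_le_left (Nat.cast_nonneg (a n)) hc).trans (hlac n).le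
  exact_mod_cast h

theorem pow_mul_choose_le (N : ℕ) (hN : 1 ≤ N) (Q : ℝ) (hQ : 0 ≤ Q) :
    (Q / N) ^ (Nat.log 2 N + 1) * (N.choose (Nat.log 2 N + 1) : ℕ) ≤
      Real.exp (8 * Q) * (1 / (N : ℝ) ^ 3) := by
  have hN0 : (0 : ℝ) < N := by exact_mod_cast hN
  set M := Nat.log 2 N + 1
  have h2 : (N : ℝ) ≤ 2 ^ M := by exact_mod_cast (Nat.lt_pow_succ_log_self one_lt_two N).le
  have h8 : (N : ℝ) ^ 3 ≤ 8 ^ M := by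
    calc (N : ℝ) ^ 3 ≤ (2 ^ M) ^ 3 := by gcongr
      _ = 8 ^ M := by rw [← pow_mul, mul_comm, pow_mul]; norm_num
  calc (Q / N) ^ M * (N.choose M : ℕ) ≤ (Q / N) ^ M * ((N : ℝ) ^ M / M.factorial) := by
        gcongr
        exact Nat.choose_le_pow_div M N
    _ = (8 * Q) ^ M / M.factorial * (1 / 8 ^ M) := by
        rw [div_pow, mul_pow]; field_simp
    _ ≤ _ := by
        gcongr
        exact Real.pow_div_factorial_le_exp _ (by positivity) _

open Classical in
theorem ae_eventually_card_hitSet_le {c : ℝ} (hc : 1 < c) (a : ℕ → ℕ) (ha : ∀ n, 0 < a n)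
    (hlac : ∀ n, c * a n < a (n + 1)) (W : ℕ) :
    ∃ K : ℕ, ∀ᵐ α ∂(volume.restrict (Set.Icc (0 : ℝ) 1)), ∀ᶠ N : ℕ in Filter.atTop, ∀ j < N,
      ((Finset.Icc 1 N).filter fun x => α ∈ hitSet N W j (a x)).card ≤
        K * (Nat.log 2 N + 1) ^ 2 := by
  obtain ⟨K, hK⟩ := pow_unbounded_of_one_lt 2 hc
  have hK1 : 1 ≤ K := by
    by_contra h
    rw [show K = 0 by omega] at hK
    norm_num at hK
  refine ⟨K, ?_⟩
  let s : ℕ → Set ℝ := fun N => ⋃ j ∈ Finset.range N,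
    separatedHits (fun x => hitSet N W j (a x)) (K * (Nat.log 2 N + 1)) N (Nat.log 2 N + 1) 1
  have hgap : ∀ N n, N * a n ≤ a (n + K * (Nat.log 2 N + 1)) := by
    intro N n
    have h1 := pow_mul_le_of_lacunary (by linarith) hlac (K * (Nat.log 2 N + 1)) n
    have h2 : (N : ℝ) ≤ 2 ^ (Nat.log 2 N + 1) := by
      exact_mod_cast (Nat.lt_pow_succ_log_self one_lt_two N).le
    have h3 : (N : ℝ) ≤ c ^ (K * (Nat.log 2 N + 1)) := by
      rw [pow_mul]
      exact h2.trans (by gcongr)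
    have h4 := (mul_le_mul_of_nonneg_right h3 (Nat.cast_nonneg (a n))).trans h1
    exact_mod_cast h4
  have hs : ∀ N, volume.restrict (Set.Icc (0 : ℝ) 1) (s N) ≤
      ENNReal.ofReal ((W + 2) * Real.exp (8 * (2 * W + 1)) * (1 / (N : ℝ) ^ 2)) := by
    intro N
    rcases Nat.eq_zero_or_pos N with rfl | hN
    · simp [s]
    have hN0 : (0 : ℝ) < N := by exact_mod_cast hN
    rw [Measure.restrict_apply' measurableSet_Icc, Set.inter_comm]
    simp only [s, Set.inter_iUnion₂]
    calc _ ≤ ∑ j ∈ Finset.range N, ENNReal.ofReal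
          ((W + 2) * (Real.exp (8 * (2 * W + 1)) * (1 / (N : ℝ) ^ 3))) := by
          refine (measure_biUnion_finset_le _ _).trans (Finset.sum_le_sum fun j _ => ?_)
          refine (volume_separatedHits_le a ha (monotone_of_lacunary hc.le hlac) N W j _ hN
            (Nat.mul_pos hK1 (Nat.succ_pos _)) (hgap N) _ 1 0 1 zero_le_one).trans
            (ENNReal.ofReal_le_ofReal ?_)
          have h1 : (W + 1 : ℝ) / a 1 ≤ W + 1 :=
            div_le_self (by positivity) (by exact_mod_cast ha 1)
          have h2 := pow_mul_choose_le N hN (2 * W + 1) (by positivity)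
          rw [Nat.add_sub_cancel]
          refine mul_le_mul (by linarith) h2 (by positivity) (by positivity)
      _ = _ := by
          rw [Finset.sum_const, Finset.card_range, nsmul_eq_mul, ← ENNReal.ofReal_natCast,
            ← ENNReal.ofReal_mul hN0.le]
          congr 1
          field_simp
  have hsum : (∑' N, volume.restrict (Set.Icc (0 : ℝ) 1) (s N)) ≠ ⊤ := by
    refine ne_top_of_le_ne_top ?_ (ENNReal.tsum_le_tsum hs)
    exact ((Real.summable_one_div_nat_pow.2 one_lt_two).mul_left _).tsum_ofReal_ne_top
  filter_upwards [ae_eventually_notMem hsum] with α hα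
  filter_upwards [hα] with N hN j hj
  refine (card_hits_le (fun x => hitSet N W j (a x)) (K * (Nat.log 2 N + 1)) N α
    (Nat.log 2 N + 1) 1 fun h => hN (Set.mem_iUnion₂.2 ⟨j, Finset.mem_range.2 hj, h⟩)).trans_eq ?_
  ring

open Classical in
theorem Rk_le (a : ℕ → ℕ) {d : ℕ} (f : (Fin d → ℝ) → ℝ) (B : ℝ) (D : ℕ)
    (hB0 : 0 ≤ B) (hB : ∀ y, f y ≤ B) (hD : ∀ y, f y ≠ 0 → ∀ i, |y i| ≤ D)
    (N : ℕ) (hN : 1 ≤ N) (α : ℝ) (P : ℕ)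
    (hP : ∀ j < N, ((Finset.Icc 1 N).filter fun x => α ∈ hitSet N (2 * D + 1) j (a x)).card ≤ P) :
    Rk a (d + 1) f N α ≤ B * (2 * D + 1 : ℝ) ^ d * P ^ d := by
  have hN0 : (0 : ℝ) < N := by exact_mod_cast hN
  let r : ℕ → ℕ → Prop := fun y x => ∃ m : ℤ, |(N : ℝ) * (m + α * ((a y : ℝ) - a x))| ≤ D
  have hr : ∀ y ∈ Finset.Icc 1 N, ((Finset.Icc 1 N).filter fun x => r y x).card ≤ P := by
    intro y _
    have hNz : (N : ℤ) ≠ 0 := by omega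
    set p : ℤ := ⌊N * (α * a y)⌋ - D with hp
    obtain ⟨j, hj⟩ := Int.eq_ofNat_of_zero_le (Int.emod_nonneg p hNz)
    have hjN : j < N := by
      have := Int.emod_lt_of_pos p (by omega : (0 : ℤ) < N)
      omega
    refine (Finset.card_le_card fun x hx => ?_).trans (hP j hjN)
    rw [Finset.mem_filter] at hx ⊢
    obtain ⟨hx, m, hm⟩ := hx
    refine ⟨hx, m + p / N, ?_⟩
    rw [abs_le] at hm
    have hdiv : (p : ℝ) = N * ((p / N : ℤ) : ℝ) + j := by
      have := Int.mul_ediv_add_emod p N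
      rw [hj] at this
      exact_mod_cast this.symm
    have h1 := Int.floor_le (N * (α * a y))
    have h2 := Int.lt_floor_add_one (N * (α * a y))
    have h3 : (p : ℝ) = ⌊N * (α * a y)⌋ - D := by rw [hp]; push_cast; ring
    push_cast
    constructor
    · rw [← le_sub_iff_add_le', div_le_iff₀ hN0]
      nlinarith
    · rw [← sub_le_iff_le_add', le_div_iff₀ hN0]
      nlinarith
  let T := (Fintype.piFinset fun _ : Fin (d + 1) => Finset.Icc 1 N).filter
    fun x => ∀ i : Fin d, r (x i.castSucc) (x i.succ)
  have hT : (T.card : ℝ) ≤ N * P ^ d := by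
    have := card_chain_le (Finset.Icc 1 N) r P hr d
    rw [Nat.card_Icc, Nat.add_sub_cancel] at this
    exact_mod_cast this
  have hC : 0 ≤ B * (2 * D + 1 : ℝ) ^ d := by positivity
  let g : (Fin (d + 1) → ℕ) → ℝ := fun x => ∑' m : Fin d → ℤ, f fun i =>
    (N : ℝ) * ((m i : ℝ) + α * ((a (x i.castSucc) : ℝ) - (a (x i.succ) : ℝ)))
  have hg : ∀ x, g x ≤ B * (2 * D + 1 : ℝ) ^ d := fun x =>
    tsum_le_of_support_bounded f B D hB0 hB hD N hN _
  have hg0 : ∀ x, (¬ ∀ i : Fin d, r (x i.castSucc) (x i.succ)) → g x = 0 := by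
    intro x hx
    refine (tsum_congr fun m => ?_).trans tsum_zero
    by_contra h
    exact hx fun i => ⟨m i, hD _ h i⟩
  calc Rk a (d + 1) f N α = (1 / (N : ℝ)) * ∑ x ∈ (Fintype.piFinset fun _ : Fin (d + 1) =>
        Finset.Icc 1 N).filter Function.Injective, g x := by
          unfold Rk
          congr 2
    _ ≤ (1 / (N : ℝ)) * (T.card * (B * (2 * D + 1 : ℝ) ^ d)) := by
        gcongr
        calc _ ≤ ∑ x ∈ Fintype.piFinset fun _ : Fin (d + 1) => Finset.Icc 1 N,
              if (∀ i : Fin d, r (x i.castSucc) (x i.succ)) then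
                B * (2 * D + 1 : ℝ) ^ d else 0 := by
              refine (Finset.sum_le_sum fun x _ => ?_).trans
                (Finset.sum_le_sum_of_subset_of_nonneg (Finset.filter_subset _ _) ?_)
              · split_ifs with h
                · exact hg x
                · exact (hg0 x h).le
              · intro x _ _
                split_ifs
                exacts [hC, le_rfl]
          _ = _ := by rw [← Finset.sum_filter, Finset.sum_const, nsmul_eq_mul]
    _ ≤ (1 / (N : ℝ)) * (N * P ^ d * (B * (2 * D + 1 : ℝ) ^ d)) := by gcongr
    _ = _ := by field_simp

theorem exists_log_pow_le_rpow (n : ℕ) {ε : ℝ} (hε : 0 < ε) :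
    ∃ C : ℝ, 0 ≤ C ∧ ∀ N : ℕ, 1 ≤ N → ((Nat.log 2 N + 1 : ℕ) : ℝ) ^ n ≤ C * (N : ℝ) ^ ε := by
  rcases Nat.eq_zero_or_pos n with rfl | hn
  · exact ⟨1, zero_le_one, fun N hN => by
      simpa using Real.one_le_rpow (by exact_mod_cast hN) hε.le⟩
  have hn0 : (0 : ℝ) < n := by exact_mod_cast hn
  have hδ : 0 < ε / n := by positivity
  have hlog : 0 < Real.log 2 := Real.log_pos one_lt_two
  refine ⟨(1 / (ε / n) / Real.log 2 + 1) ^ n, by positivity, fun N hN => ?_⟩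
  have h1 : (1 : ℝ) ≤ (N : ℝ) ^ (ε / n) := Real.one_le_rpow (by exact_mod_cast hN) hδ.le
  have h2 : (Nat.log 2 N : ℝ) ≤ Real.log N / Real.log 2 := Real.natLog_le_logb N 2
  have h3 := div_le_div_of_nonneg_right (Real.log_natCast_le_rpow_div N hδ) hlog.le
  have h4 : ((Nat.log 2 N + 1 : ℕ) : ℝ) ≤
      (1 / (ε / n) / Real.log 2 + 1) * (N : ℝ) ^ (ε / n) := by
    push_cast
    calc (Nat.log 2 N : ℝ) + 1 ≤ (N : ℝ) ^ (ε / n) / (ε / n) / Real.log 2 +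
          (N : ℝ) ^ (ε / n) := add_le_add (h2.trans h3) h1
      _ = _ := by ring
  calc _ ≤ ((1 / (ε / n) / Real.log 2 + 1) * (N : ℝ) ^ (ε / n)) ^ n := by gcongr
    _ = _ := by
      rw [mul_pow, ← Real.rpow_natCast ((N : ℝ) ^ (ε / n)), ← Real.rpow_mul (Nat.cast_nonneg _),
        div_mul_cancel₀ _ hn0.ne']

theorem exists_bound_of_eventually_le {u v : ℕ → ℝ} {C : ℝ} (hC : 0 ≤ C)
    (hv : ∀ N, 1 ≤ N → 1 ≤ v N) (h : ∀ᶠ N in Filter.atTop, u N ≤ C * v N) :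
    ∃ C' : ℝ, ∀ N, 1 ≤ N → u N ≤ C' * v N := by
  obtain ⟨N₀, hN₀⟩ := Filter.eventually_atTop.1 h
  have hS : 0 ≤ ∑ n ∈ Finset.range N₀, |u n| := Finset.sum_nonneg fun _ _ => abs_nonneg _
  refine ⟨C + ∑ n ∈ Finset.range N₀, |u n|, fun N hN => ?_⟩
  have hv1 := hv N hN
  rw [add_mul]
  by_cases hlt : N < N₀
  · have h1 : |u N| ≤ ∑ n ∈ Finset.range N₀, |u n| :=
      Finset.single_le_sum (f := fun n => |u n|) (fun _ _ => abs_nonneg _)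
        (Finset.mem_range.2 hlt)
    have h2 := le_mul_of_one_le_right hS hv1
    have h3 : 0 ≤ C * v N := by positivity
    linarith [le_abs_self (u N)]
  · have h1 := hN₀ N (by omega)
    have h2 : 0 ≤ (∑ n ∈ Finset.range N₀, |u n|) * v N := by positivity
    linarith

theorem exists_bounds_of_hasCompactSupport {d : ℕ} {f : (Fin d → ℝ) → ℝ} (hf : Continuous f)
    (hsupp : HasCompactSupport f) :
    ∃ (B : ℝ) (D : ℕ), 0 ≤ B ∧ (∀ y, f y ≤ B) ∧ ∀ y, f y ≠ 0 → ∀ i, |y i| ≤ D := by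
  obtain ⟨B, hB⟩ := hsupp.exists_bound_of_continuous hf
  obtain ⟨R, hR⟩ := hsupp.isCompact.isBounded.exists_norm_le
  obtain ⟨D, hD⟩ := exists_nat_ge R
  exact ⟨B, D, (norm_nonneg _).trans (hB 0), fun y => (le_abs_self _).trans (hB y),
    fun y hy i => (norm_le_pi_norm y i).trans ((hR y (subset_tsupport f hy)).trans hD)⟩

/-- A priori bound: for a nonnegative test function `f`, for almost every `α`,
`R_k(f,N)(α) ≪_{α,f,ε} N^ε`. -/
theorem stmt10 (c : ℝ) (hc : 1 < c) (a : ℕ → ℕ) (ha : ∀ n, 0 < a n)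
    (hlac : ∀ n, c * a n < a (n + 1)) (k : ℕ) (hk : 2 ≤ k)
    (f : (Fin (k - 1) → ℝ) → ℝ) (hf : ContDiff ℝ (⊤ : ℕ∞) f) (hsupp : HasCompactSupport f)
    (hpos : ∀ y, 0 ≤ f y) :
    ∀ᵐ α ∂(volume.restrict (Set.Icc (0 : ℝ) 1)),
      ∀ ε : ℝ, 0 < ε → ∃ C : ℝ, ∀ N : ℕ, 1 ≤ N →
        Rk a k f N α ≤ C * (N : ℝ) ^ ε := by
  obtain ⟨d, rfl⟩ : ∃ d, k = d + 1 := ⟨k - 1, by omega⟩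
  obtain ⟨B, D, hB0, hB, hD⟩ := exists_bounds_of_hasCompactSupport hf.continuous hsupp
  obtain ⟨K, hK⟩ := ae_eventually_card_hitSet_le hc a ha hlac (2 * D + 1)
  filter_upwards [hK] with α hα ε hε
  obtain ⟨C, hC0, hC⟩ := exists_log_pow_le_rpow (2 * d) hε
  refine exists_bound_of_eventually_le (C := B * (2 * D + 1 : ℝ) ^ d * K ^ d * C) (by positivity)
    (fun N hN => Real.one_le_rpow (by exact_mod_cast hN) hε.le) ?_
  filter_upwards [hα, Filter.eventually_ge_atTop 1] with N hN hN1
  calc Rk a (d + 1) f N α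
      ≤ B * (2 * D + 1 : ℝ) ^ d * ((K * (Nat.log 2 N + 1) ^ 2 : ℕ) : ℝ) ^ d :=
        Rk_le a f B D hB0 hB hD N hN1 α _ hN
    _ = B * (2 * D + 1 : ℝ) ^ d * K ^ d * ((Nat.log 2 N + 1 : ℕ) : ℝ) ^ (2 * d) := by
        rw [Nat.cast_mul, mul_pow, Nat.cast_pow, ← pow_mul, ← mul_assoc]
    _ ≤ B * (2 * D + 1 : ℝ) ^ d * K ^ d * (C * (N : ℝ) ^ ε) := by
        gcongr
        exact hC N hN1
    _ = _ := by ring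
end
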